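/- arXiv:1510.06990 — 3 statements merged into one kernel-verified Lean document; each statement's English description precedes it below -/
import Mathlib

section
/- Let N ≥ 1, 0 < ε ≤ 1 and 0 < δ < ε/3. There is a constant C = C(ε, δ), independent of N, such that for every γ ∈ L¹(ℝ^N) with ‖γ‖_{𝔅_ε(ℝ^N)} < ∞, the function J₁γ defined (for s_1 ≠ 0) by J₁γ(s_1, …, s_N) := s_1^{−2} γ(s_1^{−1}, s_2, …, s_N) belongs to L¹(ℝ^N) and satisfies ‖J₁γ‖_{𝔅_δ(ℝ^N)} ≤ C ‖γ‖_{𝔅_ε(ℝ^N)}. -/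
open MeasureTheory
open scoped ENNReal NNReal

noncomputable section

/-- The norm `‖γ‖_{𝔅_ε(ℝ^N)}`. -/
noncomputable def fB (N : ℕ) (ε : ℝ) (γ : (Fin N → ℝ) → ℂ) : ℝ≥0∞ :=
  (⨆ i : Fin N, ∫⁻ s : Fin N → ℝ,
      ENNReal.ofReal ((1 + |s i|) ^ ε) * (‖γ s‖₊ : ℝ≥0∞)) +
  ⨆ i : Fin N, ⨆ h : Set.Ioc (0 : ℝ) 1,
    ENNReal.ofReal ((h : ℝ) ^ (-ε)) *
      ∫⁻ s : Fin N → ℝ,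
        (‖γ (s + (h : ℝ) • (Pi.single i 1 : Fin N → ℝ)) - γ s‖₊ : ℝ≥0∞)

/-- The inversion `J₁γ(s_1,…,s_N) = s_1^{−2} γ(s_1^{−1}, s_2, …, s_N)`
(here `N` is replaced by `N+1` so that `N+1 ≥ 1`). -/
noncomputable def J1 (N : ℕ) (γ : (Fin (N + 1) → ℝ) → ℂ) : (Fin (N + 1) → ℝ) → ℂ :=
  fun s => ((((s 0) ^ 2)⁻¹ : ℝ) : ℂ) * γ (Function.update s 0 (s 0)⁻¹)

/-- The inversion `s ↦ s⁻¹` changes Lebesgue measure by the density `s⁻²`. -/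
theorem lintegral_inv_sq_mul_comp_inv (F : ℝ → ℝ≥0∞) :
    ∫⁻ s : ℝ, ENNReal.ofReal ((s ^ 2)⁻¹) * F s⁻¹ = ∫⁻ t, F t := by
  have himg : (fun s : ℝ => s⁻¹) '' {0}ᶜ = {0}ᶜ := by
    ext x
    simp only [Set.mem_image, Set.mem_compl_iff, Set.mem_singleton_iff]
    exact ⟨fun ⟨y, hy, h⟩ => h ▸ inv_ne_zero hy, fun h => ⟨x⁻¹, inv_ne_zero h, inv_inv x⟩⟩
  have hcompl : ∀ G : ℝ → ℝ≥0∞, ∫⁻ t in ({0}ᶜ : Set ℝ), G t = ∫⁻ t, G t := fun G => by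
    rw [restrict_compl_singleton]
  have key := lintegral_image_eq_lintegral_abs_deriv_mul (s := ({0}ᶜ : Set ℝ))
    (f := fun s : ℝ => s⁻¹) (f' := fun s => -(s ^ 2)⁻¹) (measurableSet_singleton 0).compl
    (fun x hx => (hasDerivAt_inv hx).hasDerivWithinAt) inv_injective.injOn F
  rw [himg, hcompl, hcompl] at key
  rw [key]
  refine lintegral_congr fun s => ?_
  rw [abs_neg, abs_of_nonneg (by positivity)]

/-- Abstract one-dimensional data attached to an `L¹`-function `t ↦ f t` with values in a normed
space: `m t` plays the role of `‖f t‖` and `d a b` that of `‖f a - f b‖`. -/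
structure IsModulus (ε : ℝ) (B : ℝ≥0∞) (m : ℝ → ℝ≥0∞) (d : ℝ → ℝ → ℝ≥0∞) : Prop where
  measurable_m : Measurable m
  measurable_d : Measurable (Function.uncurry d)
  d_self : ∀ a, d a a = 0
  d_comm : ∀ a b, d a b = d b a
  d_triangle : ∀ a b c, d a b ≤ d a c + d c b
  m_le : ∀ a b, m a ≤ m b + d b a
  lintegral_weight_le : ∫⁻ t, ENNReal.ofReal ((1 + |t|) ^ ε) * m t ≤ B
  lintegral_pos_shift_le : ∀ h : ℝ, 0 < h → h ≤ 1 →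
    ∫⁻ t, d (t + h) t ≤ ENNReal.ofReal (h ^ ε) * B

namespace IsModulus

variable {ε : ℝ} {B : ℝ≥0∞} {m : ℝ → ℝ≥0∞} {d : ℝ → ℝ → ℝ≥0∞}

theorem lintegral_m_le (H : IsModulus ε B m d) (hε : 0 < ε) : ∫⁻ t, m t ≤ B := by
  refine le_trans (lintegral_mono fun t => ?_) H.lintegral_weight_le
  have : (1 : ℝ) ≤ (1 + |t|) ^ ε :=
    Real.one_le_rpow (by linarith [abs_nonneg t]) hε.le
  calc m t = 1 * m t := (one_mul _).symm
    _ ≤ _ := by gcongr; simpa using ENNReal.ofReal_le_ofReal this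

theorem measurable_shift (H : IsModulus ε B m d) :
    Measurable fun p : ℝ × ℝ => d (p.1 + p.2) p.1 :=
  H.measurable_d.comp ((measurable_fst.add measurable_snd).prodMk measurable_fst)

theorem lintegral_shift_le (H : IsModulus ε B m d) {u : ℝ} (hu : |u| ≤ 1) :
    ∫⁻ t, d (t + u) t ≤ ENNReal.ofReal (|u| ^ ε) * B := by
  rcases lt_trichotomy u 0 with h | h | h
  · rw [abs_of_neg h] at hu ⊢
    rw [← lintegral_add_right_eq_self _ (-u)]
    simpa [H.d_comm] using H.lintegral_pos_shift_le (-u) (by linarith) hu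
  · subst h; simp [H.d_self]
  · rw [abs_of_pos h] at hu ⊢
    exact H.lintegral_pos_shift_le u h hu

/-- The oscillation `∫_{|u| ≤ r} d (t + u) t du` integrates to `O(r^{1+ε})`. -/
theorem lintegral_osc_le (H : IsModulus ε B m d) (hε : 0 < ε) {r : ℝ} (hr : r ≤ 1) :
    ∫⁻ t, ∫⁻ u in Set.Icc (-r) r, d (t + u) t ≤
      ENNReal.ofReal (2 * r) * (ENNReal.ofReal (r ^ ε) * B) := by
  rw [lintegral_lintegral_swap H.measurable_shift.aemeasurable]
  calc ∫⁻ u in Set.Icc (-r) r, ∫⁻ t, d (t + u) t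
      ≤ ∫⁻ u in Set.Icc (-r) r, ENNReal.ofReal (r ^ ε) * B := by
        refine setLIntegral_mono measurable_const fun u hu => ?_
        have h : |u| ≤ r := abs_le.2 hu
        refine (H.lintegral_shift_le (h.trans hr)).trans ?_
        gcongr
    _ = _ := by
        rw [setLIntegral_const, Real.volume_Icc, mul_comm]
        congr 2; ring

theorem measurable_osc (H : IsModulus ε B m d) (r : ℝ) :
    Measurable fun t => ∫⁻ u in Set.Icc (-r) r, d (t + u) t :=
  H.measurable_shift.lintegral_prod_right'

theorem mul_d_le_osc (H : IsModulus ε B m d) {ρ a b : ℝ} (hρ : 0 < ρ) (hab : |a - b| ≤ 2 * ρ) :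
    ENNReal.ofReal ρ * d a b ≤
      (∫⁻ u in Set.Icc (-(3 * ρ)) (3 * ρ), d (a + u) a) +
        ∫⁻ u in Set.Icc (-(3 * ρ)) (3 * ρ), d (b + u) b := by
  have hosc : ∀ c, ∫⁻ u in Set.Icc (-(3 * ρ)) (3 * ρ), d (c + u) c =
      ∫⁻ z, (Set.Icc (c - 3 * ρ) (c + 3 * ρ)).indicator (fun z => d z c) z := fun c => by
    rw [← lintegral_indicator measurableSet_Icc, 
      ← lintegral_add_left_eq_self ((Set.Icc _ _).indicator fun z => d z c) c]
    refine lintegral_congr fun u => ?_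
    simp only [Set.indicator, Set.mem_Icc]
    congr 1
    apply propext
    constructor <;> rintro ⟨_, _⟩ <;> constructor <;> linarith
  have hmeas : ∀ c, Measurable fun z => d z c := fun c =>
    H.measurable_d.comp (measurable_id.prodMk measurable_const)
  have hconst : ENNReal.ofReal ρ * d a b = ∫⁻ z, (Set.Icc a (a + ρ)).indicator
      (fun _ => d a b) z := by
    rw [lintegral_indicator measurableSet_Icc, setLIntegral_const, Real.volume_Icc,
      add_sub_cancel_left, mul_comm]
  rw [hosc, hosc, hconst, ← lintegral_add_left ((hmeas a).indicator measurableSet_Icc)]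
  refine lintegral_mono fun z => ?_
  by_cases hz : z ∈ Set.Icc a (a + ρ)
  · obtain ⟨h1, h2⟩ := id hz
    obtain ⟨h3, h4⟩ := abs_le.1 hab
    rw [Set.indicator_of_mem hz,
      Set.indicator_of_mem (show z ∈ Set.Icc _ _ from ⟨by linarith, by linarith⟩),
      Set.indicator_of_mem (show z ∈ Set.Icc _ _ from ⟨by linarith, by linarith⟩), H.d_comm z a]
    exact H.d_triangle a b z
  · rw [Set.indicator_of_notMem hz]
    exact zero_le

theorem lintegral_indicator_abs_rpow_lt_top {p : ℝ} (hp : -1 < p) :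
    ∫⁻ t : ℝ, (Set.Ioo (0 : ℝ) 1).indicator (fun x => ENNReal.ofReal (x ^ p)) |t| < ⊤ := by
  set g : ℝ → ℝ≥0∞ := (Set.Ioo (0 : ℝ) 1).indicator (fun x => ENNReal.ofReal (x ^ p))
  have hgm : Measurable g :=
    ((measurable_id.pow_const p).ennreal_ofReal).indicator measurableSet_Ioo
  have hg : ∫⁻ t, g t < ⊤ := by
    rw [lintegral_indicator measurableSet_Ioo]
    exact ((intervalIntegral.integrableOn_Ioo_rpow_iff one_pos).2 hp).setLIntegral_lt_top
  calc ∫⁻ t, g |t| ≤ ∫⁻ t, (g t + g (-t)) := by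
        refine lintegral_mono fun t => ?_
        rcases abs_choice t with h | h
        · exact (congrArg g h).le.trans le_self_add
        · exact (congrArg g h).le.trans le_add_self
    _ = (∫⁻ t, g t) + ∫⁻ t, g t := by
        rw [lintegral_add_left hgm, lintegral_neg_eq_self g]
    _ < ⊤ := ENNReal.add_lt_top.2 ⟨hg, hg⟩

theorem rpow_neg_mul_m_le (H : IsModulus ε B m d) {δ t : ℝ} (hδ : 0 < δ) (ht0 : 0 < |t|)
    (ht1 : |t| < 1) :
    ENNReal.ofReal (|t| ^ (-δ)) * m t ≤ ENNReal.ofReal (|t| ^ (-δ - 1 / 2)) * (∫⁻ z, m z) +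
      ∫⁻ u in Set.Ioo (0 : ℝ) 1, ENNReal.ofReal (u ^ (-2 * δ - 1)) * d (t + u) t := by
  set r := |t| ^ (1 / 2 : ℝ) with hr
  have hr0 : 0 < r := Real.rpow_pos_of_pos ht0 _
  have hr1 : r ≤ 1 := Real.rpow_le_one ht0.le ht1.le (by norm_num)
  have hmd : Measurable fun u => d (t + u) t :=
    H.measurable_d.comp ((measurable_const.add measurable_id).prodMk measurable_const)
  have havg : ENNReal.ofReal r * m t ≤
      (∫⁻ z, m z) + ∫⁻ u in Set.Ioo (0 : ℝ) r, d (t + u) t := by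
    calc ENNReal.ofReal r * m t = ∫⁻ u in Set.Ioo (0 : ℝ) r, m t := by
          rw [setLIntegral_const, Real.volume_Ioo, sub_zero, mul_comm]
      _ ≤ ∫⁻ u in Set.Ioo (0 : ℝ) r, (m (t + u) + d (t + u) t) :=
          lintegral_mono fun u => H.m_le _ _
      _ = (∫⁻ u in Set.Ioo (0 : ℝ) r, m (t + u)) + ∫⁻ u in Set.Ioo (0 : ℝ) r, d (t + u) t :=
          lintegral_add_right _ hmd
      _ ≤ _ := by
          refine add_le_add ?_ le_rfl
          exact (setLIntegral_le_lintegral _ _).trans (lintegral_add_left_eq_self m t).le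
  have hsplit : |t| ^ (-δ) = |t| ^ (-δ - 1 / 2) * r := by
    rw [hr, ← Real.rpow_add ht0]; ring_nf
  rw [hsplit, ENNReal.ofReal_mul (by positivity), mul_assoc]
  refine (mul_le_mul_right havg _).trans ?_
  rw [mul_add, ← lintegral_const_mul _ hmd]
  refine add_le_add le_rfl ?_
  refine (setLIntegral_mono' measurableSet_Ioo fun u hu => ?_).trans
    (lintegral_mono_set (Set.Ioo_subset_Ioo_right hr1))
  gcongr ENNReal.ofReal ?_ * _
  have : |t| = r ^ (2 : ℝ) := by rw [hr, ← Real.rpow_mul ht0.le]; norm_num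
  rw [this, ← Real.rpow_mul hr0.le, show 2 * (-δ - 1 / 2) = -2 * δ - 1 by ring]
  exact Real.rpow_le_rpow_of_nonpos hu.1 hu.2.le (by linarith)

/-- Smoothness of order `ε` controls the singular weight `|t|^{-δ}` at the origin. -/
theorem exists_lintegral_inv_weight_le {ε δ : ℝ} (hε : 0 < ε) (hε1 : ε ≤ 1) (hδ0 : 0 < δ)
    (hδ : δ < ε / 2) :
    ∃ C : ℝ≥0, ∀ (B : ℝ≥0∞) (m : ℝ → ℝ≥0∞) (d : ℝ → ℝ → ℝ≥0∞), IsModulus ε B m d →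
      ∫⁻ t, ENNReal.ofReal ((1 + |t|⁻¹) ^ δ) * m t ≤ C * B := by
  set g : ℝ → ℝ≥0∞ :=
    (Set.Ioo (0 : ℝ) 1).indicator (fun x => ENNReal.ofReal (x ^ (-δ - 1 / 2)))
  set w : ℝ → ℝ≥0∞ := fun u => ENNReal.ofReal (u ^ (-2 * δ - 1))
  have hc1 : ∫⁻ t : ℝ, g |t| < ⊤ := lintegral_indicator_abs_rpow_lt_top (by linarith)
  have hc2 : ∫⁻ u in Set.Ioo (0 : ℝ) 1, ENNReal.ofReal (u ^ (-2 * δ - 1 + ε)) < ⊤ :=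
    ((intervalIntegral.integrableOn_Ioo_rpow_iff one_pos).2 (by linarith)).setLIntegral_lt_top
  have hgm : Measurable fun t : ℝ => g |t| :=
    (((measurable_id.pow_const _).ennreal_ofReal).indicator measurableSet_Ioo).comp
      continuous_abs.measurable
  have hwm : Measurable w := (measurable_id.pow_const _).ennreal_ofReal
  set c : ℝ≥0∞ := 2 + 2 * ((∫⁻ t : ℝ, g |t|) +
    ∫⁻ u in Set.Ioo (0 : ℝ) 1, ENNReal.ofReal (u ^ (-2 * δ - 1 + ε))) with hc
  have hctop : c ≠ ⊤ := by
    rw [hc]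
    have := (ENNReal.add_lt_top.2 ⟨hc1, hc2⟩).ne
    finiteness
  refine ⟨c.toNNReal, fun B m d H => ?_⟩
  rw [ENNReal.coe_toNNReal hctop]
  set T : ℝ → ℝ≥0∞ := fun t => ∫⁻ u in Set.Ioo (0 : ℝ) 1, w u * d (t + u) t
  have hjoint : Measurable fun p : ℝ × ℝ => w p.2 * d (p.1 + p.2) p.1 :=
    (hwm.comp measurable_snd).mul H.measurable_shift
  have hTm : Measurable T := hjoint.lintegral_prod_right'
  have hT : ∫⁻ t, T t ≤
      (∫⁻ u in Set.Ioo (0 : ℝ) 1, ENNReal.ofReal (u ^ (-2 * δ - 1 + ε))) * B := by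
    have hm' : Measurable fun u : ℝ => ENNReal.ofReal (u ^ (-2 * δ - 1 + ε)) :=
      (measurable_id.pow_const _).ennreal_ofReal
    rw [lintegral_lintegral_swap hjoint.aemeasurable, ← lintegral_mul_const _ hm']
    refine setLIntegral_mono' measurableSet_Ioo fun u hu => ?_
    have hd : Measurable fun t => d (t + u) t :=
      H.measurable_shift.comp (measurable_id.prodMk measurable_const)
    rw [lintegral_const_mul _ hd, Real.rpow_add hu.1,
      ENNReal.ofReal_mul (Real.rpow_nonneg hu.1.le _), mul_assoc]
    exact mul_le_mul_right (H.lintegral_pos_shift_le u hu.1 hu.2.le) _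
  have hpt : ∀ t, ENNReal.ofReal ((1 + |t|⁻¹) ^ δ) * m t ≤
      2 * m t + 2 * (g |t| * (∫⁻ z, m z) + T t) := by
    intro t
    by_cases h : 0 < |t| ∧ |t| < 1
    · obtain ⟨h0, h1⟩ := h
      have hbd : (1 + |t|⁻¹) ^ δ ≤ 2 * |t| ^ (-δ) := by
        have h2 : 1 + |t|⁻¹ ≤ 2 * |t|⁻¹ := by
          have := (one_lt_inv₀ h0).2 h1
          linarith
        calc (1 + |t|⁻¹) ^ δ ≤ (2 * |t|⁻¹) ^ δ := by gcongr
          _ = 2 ^ δ * |t| ^ (-δ) := by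
            rw [Real.mul_rpow (by norm_num) (by positivity), Real.inv_rpow h0.le,
              Real.rpow_neg h0.le]
          _ ≤ 2 ^ (1 : ℝ) * |t| ^ (-δ) := by
            gcongr
            · norm_num
            · linarith
          _ = _ := by rw [Real.rpow_one]
      have hgt : g |t| = ENNReal.ofReal (|t| ^ (-δ - 1 / 2)) :=
        Set.indicator_of_mem (show |t| ∈ Set.Ioo (0 : ℝ) 1 from ⟨h0, h1⟩) _
      rw [hgt]
      calc ENNReal.ofReal ((1 + |t|⁻¹) ^ δ) * m t
          ≤ ENNReal.ofReal (2 * |t| ^ (-δ)) * m t := by gcongr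
        _ = 2 * (ENNReal.ofReal (|t| ^ (-δ)) * m t) := by
            rw [ENNReal.ofReal_mul (by norm_num), mul_assoc]; simp
        _ ≤ _ := (mul_le_mul_right (H.rpow_neg_mul_m_le hδ0 h0 h1) 2).trans le_add_self
    · have hbd : (1 + |t|⁻¹) ^ δ ≤ 2 := by
        have h2 : |t|⁻¹ ≤ 1 := by
          by_cases h0 : 0 < |t|
          · exact inv_le_one_of_one_le₀ (not_lt.1 fun h1 => h ⟨h0, h1⟩)
          · rw [le_antisymm (not_lt.1 h0) (abs_nonneg t)]; simp
        calc (1 + |t|⁻¹) ^ δ ≤ 2 ^ δ := by gcongr; linarith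
          _ ≤ 2 ^ (1 : ℝ) := by
            gcongr
            · norm_num
            · linarith
          _ = 2 := Real.rpow_one 2
      calc ENNReal.ofReal ((1 + |t|⁻¹) ^ δ) * m t ≤ 2 * m t := by
            gcongr; simpa using ENNReal.ofReal_le_ofReal hbd
        _ ≤ _ := le_self_add
  calc ∫⁻ t, ENNReal.ofReal ((1 + |t|⁻¹) ^ δ) * m t
      ≤ ∫⁻ t, (2 * m t + 2 * (g |t| * (∫⁻ z, m z) + T t)) := lintegral_mono hpt
    _ = 2 * (∫⁻ t, m t) + 2 * ((∫⁻ t : ℝ, g |t|) * (∫⁻ z, m z) + ∫⁻ t, T t) := by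
        have hsum : Measurable fun t => g |t| * (∫⁻ z, m z) + T t := (hgm.mul_const _).add hTm
        rw [lintegral_add_left (H.measurable_m.const_mul 2), lintegral_const_mul _ H.measurable_m,
          lintegral_const_mul _ hsum, lintegral_add_right _ hTm,
          lintegral_mul_const _ hgm]
    _ ≤ 2 * B + 2 * ((∫⁻ t : ℝ, g |t|) * B +
          (∫⁻ u in Set.Ioo (0 : ℝ) 1, ENNReal.ofReal (u ^ (-2 * δ - 1 + ε))) * B) := by
        gcongr
        · exact H.lintegral_m_le hε
        · exact H.lintegral_m_le hε
    _ = c * B := by rw [hc]; ring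

/-- Pointwise bound for the increment of an inversion by a shift `ρ ^ 3`: `x` and `s` are the two
points, one ball of radius `ρ` around the origin being treated separately. -/
theorem inversion_increment_le (H : IsModulus ε B m d) (hε : 0 < ε) {ρ s : ℝ} (hρ : 0 < ρ)
    (hρ1 : ρ ≤ 1 / 4) {K : ℝ≥0∞} {F : ℝ → ℝ≥0∞}
    (hF : F = fun t => ENNReal.ofReal ((2 * ρ) ^ ε) * (ENNReal.ofReal ((1 + |t|) ^ ε) * m t) +
      ENNReal.ofReal (3 * ρ) * m t +
      2 * ENNReal.ofReal ρ⁻¹ * ∫⁻ u in Set.Icc (-(3 * ρ)) (3 * ρ), d (t + u) t)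
    (hK1 : K ≤ ENNReal.ofReal (((s + ρ ^ 3) ^ 2)⁻¹) * m (s + ρ ^ 3)⁻¹ +
      ENNReal.ofReal ((s ^ 2)⁻¹) * m s⁻¹)
    (hK2 : K ≤ ENNReal.ofReal (((s + ρ ^ 3) ^ 2)⁻¹) * d (s + ρ ^ 3)⁻¹ s⁻¹ +
      ENNReal.ofReal |((s + ρ ^ 3) ^ 2)⁻¹ - (s ^ 2)⁻¹| * m s⁻¹) :
    K ≤ ENNReal.ofReal (((s + ρ ^ 3) ^ 2)⁻¹) * F (s + ρ ^ 3)⁻¹ +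
      ENNReal.ofReal ((s ^ 2)⁻¹) * F s⁻¹ := by
  set x := s + ρ ^ 3 with hx
  have hh0 : 0 < ρ ^ 3 := by positivity
  have hh1 : ρ ^ 3 ≤ ρ / 16 := by nlinarith [mul_pos hρ hρ]
  by_cases hs : |s| ≤ ρ
  · have hsmall : ∀ z : ℝ, |z| ≤ 2 * ρ →
        ENNReal.ofReal ((z ^ 2)⁻¹) * m z⁻¹ ≤ ENNReal.ofReal ((z ^ 2)⁻¹) * F z⁻¹ := by
      intro z hz
      rcases eq_or_ne z 0 with rfl | hz0
      · simp
      gcongr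
      have hz0' : 0 < |z| := abs_pos.2 hz0
      have h1 : 1 ≤ (2 * ρ) ^ ε * (1 + |z⁻¹|) ^ ε := by
        rw [← Real.mul_rpow (by positivity) (by positivity)]
        refine Real.one_le_rpow ?_ hε.le
        rw [abs_inv]
        have : 1 ≤ 2 * ρ * |z|⁻¹ := by
          rw [← div_eq_mul_inv, one_le_div hz0']; exact hz
        nlinarith
      calc m z⁻¹ = 1 * m z⁻¹ := (one_mul _).symm
        _ ≤ ENNReal.ofReal ((2 * ρ) ^ ε * (1 + |z⁻¹|) ^ ε) * m z⁻¹ := by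
            gcongr; simpa using ENNReal.ofReal_le_ofReal h1
        _ = ENNReal.ofReal ((2 * ρ) ^ ε) * (ENNReal.ofReal ((1 + |z⁻¹|) ^ ε) * m z⁻¹) := by
            rw [ENNReal.ofReal_mul (by positivity), mul_assoc]
        _ ≤ F z⁻¹ := by
            simp only [hF, add_assoc]; exact le_self_add
    refine hK1.trans (add_le_add (hsmall x ?_) (hsmall s (by linarith)))
    calc |x| ≤ |s| + |ρ ^ 3| := abs_add_le _ _
      _ ≤ 2 * ρ := by rw [abs_of_pos hh0]; linarith
  · push Not at hs
    have hsx : |s| ≤ |x| + ρ ^ 3 := by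
      calc |s| = |x - ρ ^ 3| := by rw [hx]; ring_nf
        _ ≤ |x| + |ρ ^ 3| := abs_sub _ _
        _ = _ := by rw [abs_of_pos hh0]
    have hxρ : 15 / 16 * ρ ≤ |x| := by linarith
    have hx0 : 0 < |x| := by linarith
    have hs0 : 0 < |s| := by linarith
    have hxne : x ≠ 0 := abs_pos.1 hx0
    have hsne : s ≠ 0 := abs_pos.1 hs0
    have hdiff : |(x ^ 2)⁻¹ - (s ^ 2)⁻¹| ≤ 3 * ρ * (s ^ 2)⁻¹ := by
      have e : (x ^ 2)⁻¹ - (s ^ 2)⁻¹ = (s ^ 2 - x ^ 2) / x ^ 2 * (s ^ 2)⁻¹ := by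
        field_simp
      rw [e, abs_mul, abs_of_nonneg (a := (s ^ 2)⁻¹) (by positivity)]
      gcongr
      rw [abs_div, abs_of_nonneg (a := x ^ 2) (by positivity), div_le_iff₀ (by positivity)]
      have e2 : s ^ 2 - x ^ 2 = -(ρ ^ 3 * (s + x)) := by rw [hx]; ring
      rw [e2, abs_neg, abs_mul, abs_of_pos hh0, ← sq_abs x]
      have h3 : |s + x| ≤ 3 * |x| := (abs_add_le _ _).trans (by linarith)
      have h4 : ρ ^ 3 ≤ ρ * |x| := by
        have : ρ * (15 / 16 * ρ) ≤ ρ * |x| := by gcongr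
        nlinarith [mul_pos hρ hρ]
      calc ρ ^ 3 * |s + x| ≤ (ρ * |x|) * (3 * |x|) := by gcongr
        _ = 3 * ρ * |x| ^ 2 := by ring
    have hratio : (x ^ 2)⁻¹ ≤ 2 * (s ^ 2)⁻¹ := by
      rw [← div_eq_mul_inv, inv_le_comm₀ (by positivity) (by positivity), inv_div,
        ← sq_abs x, ← sq_abs s]
      nlinarith
    have hclose : |x⁻¹ - s⁻¹| ≤ 2 * ρ := by
      have e : x⁻¹ - s⁻¹ = -(ρ ^ 3) / (x * s) := by
        rw [inv_sub_inv hxne hsne, hx]; ring_nf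
      rw [e, abs_div, abs_neg, abs_of_pos hh0, abs_mul, div_le_iff₀ (by positivity)]
      have : 15 / 16 * ρ * ρ ≤ |x| * |s| := by gcongr
      nlinarith
    set E : ℝ → ℝ≥0∞ := fun t => ∫⁻ u in Set.Icc (-(3 * ρ)) (3 * ρ), d (t + u) t
    have hd : d x⁻¹ s⁻¹ ≤ ENNReal.ofReal ρ⁻¹ * (E x⁻¹ + E s⁻¹) := by
      calc d x⁻¹ s⁻¹ = ENNReal.ofReal ρ⁻¹ * (ENNReal.ofReal ρ * d x⁻¹ s⁻¹) := by
            rw [← mul_assoc, ← ENNReal.ofReal_mul (by positivity), inv_mul_cancel₀ hρ.ne']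
            simp
        _ ≤ _ := mul_le_mul_right (H.mul_d_le_osc hρ hclose) _
    have hwx : ENNReal.ofReal ((x ^ 2)⁻¹) ≤ ENNReal.ofReal ((s ^ 2)⁻¹) * 2 := by
      rw [mul_comm]
      simpa [ENNReal.ofReal_mul] using ENNReal.ofReal_le_ofReal hratio
    have hFx : ENNReal.ofReal ρ⁻¹ * E x⁻¹ ≤ F x⁻¹ := by
      rw [hF]
      refine le_trans ?_ le_add_self
      gcongr
      exact le_mul_of_one_le_left' (by norm_num)
    have hFs : ENNReal.ofReal (3 * ρ) * m s⁻¹ + 2 * ENNReal.ofReal ρ⁻¹ * E s⁻¹ ≤ F s⁻¹ := by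
      rw [hF]
      simp only [add_assoc]
      exact le_add_self
    calc K ≤ ENNReal.ofReal ((x ^ 2)⁻¹) * (ENNReal.ofReal ρ⁻¹ * (E x⁻¹ + E s⁻¹)) +
          ENNReal.ofReal (3 * ρ * (s ^ 2)⁻¹) * m s⁻¹ := by
          refine hK2.trans ?_
          gcongr
      _ = ENNReal.ofReal ((x ^ 2)⁻¹) * (ENNReal.ofReal ρ⁻¹ * E x⁻¹) +
          (ENNReal.ofReal ((x ^ 2)⁻¹) * (ENNReal.ofReal ρ⁻¹ * E s⁻¹) +
            ENNReal.ofReal ((s ^ 2)⁻¹) * (ENNReal.ofReal (3 * ρ) * m s⁻¹)) := by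
          rw [ENNReal.ofReal_mul (p := 3 * ρ) (by positivity)]; ring
      _ ≤ ENNReal.ofReal ((x ^ 2)⁻¹) * F x⁻¹ +
          (ENNReal.ofReal ((s ^ 2)⁻¹) * 2 * (ENNReal.ofReal ρ⁻¹ * E s⁻¹) +
            ENNReal.ofReal ((s ^ 2)⁻¹) * (ENNReal.ofReal (3 * ρ) * m s⁻¹)) := by
          gcongr
      _ = ENNReal.ofReal ((x ^ 2)⁻¹) * F x⁻¹ + ENNReal.ofReal ((s ^ 2)⁻¹) *
          (ENNReal.ofReal (3 * ρ) * m s⁻¹ + 2 * ENNReal.ofReal ρ⁻¹ * E s⁻¹) := by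
          ring
      _ ≤ _ := by gcongr

theorem lintegral_inversion_add_shift {F : ℝ → ℝ≥0∞} (hF : Measurable F) (h : ℝ) :
    ∫⁻ s : ℝ, (ENNReal.ofReal (((s + h) ^ 2)⁻¹) * F (s + h)⁻¹ +
      ENNReal.ofReal ((s ^ 2)⁻¹) * F s⁻¹) = 2 * ∫⁻ t, F t := by
  have hm : Measurable fun s : ℝ => ENNReal.ofReal ((s ^ 2)⁻¹) * F s⁻¹ := by fun_prop
  rw [lintegral_add_right _ hm,
    lintegral_add_right_eq_self (fun s : ℝ => ENNReal.ofReal ((s ^ 2)⁻¹) * F s⁻¹) h,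
    lintegral_inv_sq_mul_comp_inv, two_mul]

theorem lintegral_inversion_increment_le (H : IsModulus ε B m d) (hε : 0 < ε) (hε1 : ε ≤ 1)
    {δ h : ℝ} (hδ : δ ≤ ε / 3) (hh0 : 0 < h) (hh1 : h ≤ 1) {K : ℝ → ℝ≥0∞}
    (hK1 : ∀ s, K s ≤ ENNReal.ofReal (((s + h) ^ 2)⁻¹) * m (s + h)⁻¹ +
      ENNReal.ofReal ((s ^ 2)⁻¹) * m s⁻¹)
    (hK2 : ∀ s, K s ≤ ENNReal.ofReal (((s + h) ^ 2)⁻¹) * d (s + h)⁻¹ s⁻¹ +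
      ENNReal.ofReal |((s + h) ^ 2)⁻¹ - (s ^ 2)⁻¹| * m s⁻¹) :
    ∫⁻ s, K s ≤ 128 * (ENNReal.ofReal (h ^ δ) * B) := by
  rcases le_or_gt h (1 / 64) with hsmall | hlarge
  · obtain ⟨ρ, hρ, rfl⟩ : ∃ ρ : ℝ, 0 < ρ ∧ h = ρ ^ 3 :=
      ⟨h ^ (1 / 3 : ℝ), by positivity, by
        rw [← Real.rpow_natCast, ← Real.rpow_mul hh0.le]; norm_num⟩
    have hρ1 : ρ ≤ 1 / 4 := by
      refine le_of_pow_le_pow_left₀ (n := 3) (by norm_num) (by norm_num) ?_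
      norm_num at hsmall ⊢
      exact hsmall
    have hpow : ρ ^ ε ≤ (ρ ^ 3) ^ δ := by
      rw [← Real.rpow_natCast, ← Real.rpow_mul hρ.le]
      exact Real.rpow_le_rpow_of_exponent_ge hρ (by linarith) (by push_cast; linarith)
    have hscale : ∀ c : ℝ, 1 ≤ c → (c * ρ) ^ ε ≤ c * ρ ^ ε := fun c hc => by
      rw [Real.mul_rpow (by linarith) hρ.le]
      gcongr
      simpa using Real.rpow_le_rpow_of_exponent_le hc hε1
    have hρε : ρ ≤ ρ ^ ε := by
      simpa using Real.rpow_le_rpow_of_exponent_ge hρ (by linarith) hε1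
    set a := ENNReal.ofReal (ρ ^ ε) with ha
    have hmul : ∀ c x : ℝ, 0 ≤ c → x ≤ c * ρ ^ ε → ENNReal.ofReal x ≤ ENNReal.ofReal c * a :=
      fun c x hc hx => by
        rw [ha, ← ENNReal.ofReal_mul hc]; exact ENNReal.ofReal_le_ofReal hx
    set E : ℝ → ℝ≥0∞ := fun t => ∫⁻ u in Set.Icc (-(3 * ρ)) (3 * ρ), d (t + u) t
    have hEm : Measurable E := H.measurable_osc _
    have hmm := H.measurable_m
    have hE : ENNReal.ofReal ρ⁻¹ * ∫⁻ t, E t ≤ 18 * (a * B) := by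
      calc ENNReal.ofReal ρ⁻¹ * ∫⁻ t, E t
          ≤ ENNReal.ofReal ρ⁻¹ * (ENNReal.ofReal (2 * (3 * ρ)) *
              (ENNReal.ofReal ((3 * ρ) ^ ε) * B)) := by
            gcongr
            exact H.lintegral_osc_le hε (by linarith)
        _ = ENNReal.ofReal (ρ⁻¹ * (2 * (3 * ρ)) * (3 * ρ) ^ ε) * B := by
            rw [ENNReal.ofReal_mul (p := ρ⁻¹ * (2 * (3 * ρ))) (by positivity),
              ENNReal.ofReal_mul (p := ρ⁻¹) (by positivity)]
            ring
        _ ≤ ENNReal.ofReal 18 * a * B := by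
            gcongr
            refine hmul _ _ (by norm_num) ?_
            have e : ρ⁻¹ * (2 * (3 * ρ)) = 6 := by field_simp; norm_num
            rw [e]
            linarith [hscale 3 (by norm_num)]
        _ = _ := by rw [mul_assoc]; norm_num
    set F : ℝ → ℝ≥0∞ := fun t =>
      ENNReal.ofReal ((2 * ρ) ^ ε) * (ENNReal.ofReal ((1 + |t|) ^ ε) * m t) +
      ENNReal.ofReal (3 * ρ) * m t + 2 * ENNReal.ofReal ρ⁻¹ * E t with hF
    have hF1 : Measurable fun t => ENNReal.ofReal ((1 + |t|) ^ ε) * m t := by fun_prop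
    have hFm : Measurable F := by fun_prop
    have hFint : ∫⁻ t, F t ≤ 41 * (a * B) := by
      rw [lintegral_add_right _ (hEm.const_mul _), lintegral_add_right _ (hmm.const_mul _),
        lintegral_const_mul _ hF1, lintegral_const_mul _ hmm, lintegral_const_mul _ hEm,
        mul_assoc 2]
      calc _ ≤ ENNReal.ofReal 2 * a * B + ENNReal.ofReal 3 * a * B + 2 * (18 * (a * B)) := by
            gcongr
            · exact hmul _ _ (by norm_num) (hscale 2 (by norm_num))
            · exact H.lintegral_weight_le
            · exact hmul _ _ (by norm_num) (by linarith)
            · exact H.lintegral_m_le hε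
        _ = 41 * (a * B) := by norm_num; ring
    calc ∫⁻ s, K s ≤ 2 * ∫⁻ t, F t := by
          rw [← lintegral_inversion_add_shift hFm (ρ ^ 3)]
          exact lintegral_mono fun s =>
            H.inversion_increment_le hε hρ hρ1 hF (hK1 s) (hK2 s)
      _ ≤ 2 * (41 * (a * B)) := by gcongr
      _ = 82 * (a * B) := by ring
      _ ≤ 128 * (ENNReal.ofReal ((ρ ^ 3) ^ δ) * B) := by
          gcongr
          · norm_num
          · exact ENNReal.ofReal_le_ofReal hpow
  · have h1 : 1 ≤ 64 * h ^ δ := by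
      have : h ≤ h ^ δ := by
        simpa using Real.rpow_le_rpow_of_exponent_ge hh0 hh1 (show δ ≤ 1 by linarith)
      linarith
    calc ∫⁻ s, K s ≤ 2 * ∫⁻ t, m t := by
          rw [← lintegral_inversion_add_shift H.measurable_m h]
          exact lintegral_mono hK1
      _ ≤ 2 * (1 * B) := by rw [one_mul]; gcongr; exact H.lintegral_m_le hε
      _ ≤ 2 * (ENNReal.ofReal (64 * h ^ δ) * B) := by
          gcongr; simpa using ENNReal.ofReal_le_ofReal h1
      _ = _ := by
          rw [ENNReal.ofReal_mul (by norm_num)]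
          norm_num
          ring

end IsModulus

section Cube

variable {N : ℕ}

theorem lintegral_eq_lintegral_cons {Φ : (Fin (N + 1) → ℝ) → ℝ≥0∞} (hΦ : Measurable Φ) :
    ∫⁻ s, Φ s = ∫⁻ t : ℝ, ∫⁻ y : Fin N → ℝ, Φ (Fin.cons t y) := by
  have e := (volume_preserving_piFinSuccAbove (fun _ : Fin (N + 1) => ℝ) 0).symm
  rw [← e.lintegral_comp hΦ, Measure.volume_eq_prod]
  refine (lintegral_prod _ (hΦ.comp e.measurable).aemeasurable).trans ?_
  refine lintegral_congr fun t => lintegral_congr fun y => ?_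
  simp [MeasurableEquiv.piFinSuccAbove, Fin.insertNthEquiv]

theorem measurable_cons : Measurable fun p : ℝ × (Fin N → ℝ) =>
    (Fin.cons p.1 p.2 : Fin (N + 1) → ℝ) := by
  refine measurable_pi_iff.2 fun i => ?_
  refine Fin.cases ?_ (fun j => ?_) i
  · simpa using measurable_fst
  · simpa [Function.comp_def] using (measurable_pi_apply j).comp measurable_snd

theorem measurable_update_inv :
    Measurable fun s : Fin (N + 1) → ℝ => Function.update s 0 (s 0)⁻¹ := by
  refine measurable_pi_iff.2 fun i => ?_
  rcases eq_or_ne i 0 with rfl | hi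
  · simp only [Function.update_self]
    fun_prop
  · simpa [hi] using measurable_pi_apply i

theorem lintegral_inv_sq_mul_comp_update_inv {Φ : (Fin (N + 1) → ℝ) → ℝ≥0∞} (hΦ : Measurable Φ) :
    ∫⁻ s : Fin (N + 1) → ℝ,
      ENNReal.ofReal (((s 0) ^ 2)⁻¹) * Φ (Function.update s 0 (s 0)⁻¹) = ∫⁻ s, Φ s := by
  have hm : Measurable fun s : Fin (N + 1) → ℝ => ENNReal.ofReal (((s 0) ^ 2)⁻¹) *
      Φ (Function.update s 0 (s 0)⁻¹) :=
    ((((measurable_pi_apply 0).pow_const 2).inv).ennreal_ofReal).mul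
      (hΦ.comp measurable_update_inv)
  rw [lintegral_eq_lintegral_cons hm, lintegral_eq_lintegral_cons hΦ,
    ← lintegral_inv_sq_mul_comp_inv fun t => ∫⁻ y : Fin N → ℝ, Φ (Fin.cons t y)]
  refine lintegral_congr fun t => ?_
  simp only [Fin.cons_zero, Fin.update_cons_zero]
  exact lintegral_const_mul _ (hΦ.comp (measurable_cons.comp measurable_prodMk_left))

theorem J1_congr_ae {γ γ' : (Fin (N + 1) → ℝ) → ℂ} (h : γ =ᵐ[volume] γ') :
    J1 N γ =ᵐ[volume] J1 N γ' := by
  obtain ⟨S, hS, hSm, hS0⟩ := exists_measurable_superset_of_null (ae_iff.1 h)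
  have hind : Measurable (S.indicator (fun _ => (1 : ℝ≥0∞))) := measurable_const.indicator hSm
  have h0 : ∫⁻ s : Fin (N + 1) → ℝ, ENNReal.ofReal (((s 0) ^ 2)⁻¹) *
      S.indicator (fun _ => (1 : ℝ≥0∞)) (Function.update s 0 (s 0)⁻¹) = 0 := by
    rw [lintegral_inv_sq_mul_comp_update_inv hind, lintegral_indicator_const hSm, hS0, mul_zero]
  have hm : Measurable fun s : Fin (N + 1) → ℝ => ENNReal.ofReal (((s 0) ^ 2)⁻¹) *
      S.indicator (fun _ => (1 : ℝ≥0∞)) (Function.update s 0 (s 0)⁻¹) :=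
    ((((measurable_pi_apply 0).pow_const 2).inv).ennreal_ofReal).mul
      (hind.comp measurable_update_inv)
  filter_upwards [(lintegral_eq_zero_iff hm).1 h0] with s hs
  rcases mul_eq_zero.1 hs with hz | hz
  · have : ((s 0) ^ 2)⁻¹ = 0 := le_antisymm (ENNReal.ofReal_eq_zero.1 hz) (by positivity)
    simp [J1, this]
  · have hmem : Function.update s 0 (s 0)⁻¹ ∉ S := by simpa using hz
    have : γ (Function.update s 0 (s 0)⁻¹) = γ' (Function.update s 0 (s 0)⁻¹) := by
      by_contra hne; exact hmem (hS hne)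
    simp only [J1, this]

theorem fB_congr_ae (ε : ℝ) {γ γ' : (Fin N → ℝ) → ℂ} (h : γ =ᵐ[volume] γ') :
    fB N ε γ = fB N ε γ' := by
  unfold fB
  congr 1
  · refine iSup_congr fun i => lintegral_congr_ae ?_
    filter_upwards [h] with s hs
    rw [hs]
  · refine iSup_congr fun i => iSup_congr fun k => ?_
    congr 1
    refine lintegral_congr_ae ?_
    have hshift := (measurePreserving_add_right (volume : Measure (Fin N → ℝ))
      ((k : ℝ) • (Pi.single i 1 : Fin N → ℝ))).quasiMeasurePreserving.ae_eq_comp h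
    filter_upwards [h, hshift] with s hs hs'
    simp only [Function.comp_apply] at hs'
    rw [hs, hs']

theorem lintegral_weight_le_fB (ε : ℝ) (γ : (Fin N → ℝ) → ℂ) (i : Fin N) :
    ∫⁻ s, ENNReal.ofReal ((1 + |s i|) ^ ε) * (‖γ s‖₊ : ℝ≥0∞) ≤ fB N ε γ :=
  (le_iSup (fun i : Fin N => ∫⁻ s, ENNReal.ofReal ((1 + |s i|) ^ ε) * (‖γ s‖₊ : ℝ≥0∞)) i).trans
    le_self_add

theorem lintegral_shift_sub_le_fB (ε : ℝ) (γ : (Fin N → ℝ) → ℂ) (i : Fin N) {h : ℝ} (h0 : 0 < h)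
    (h1 : h ≤ 1) :
    ∫⁻ s, (‖γ (s + h • (Pi.single i 1 : Fin N → ℝ)) - γ s‖₊ : ℝ≥0∞) ≤
      ENNReal.ofReal (h ^ ε) * fB N ε γ := by
  set I := ∫⁻ s, (‖γ (s + h • (Pi.single i 1 : Fin N → ℝ)) - γ s‖₊ : ℝ≥0∞) with hI
  have hle : ENNReal.ofReal (h ^ (-ε)) * I ≤ fB N ε γ :=
    le_trans (le_iSup₂_of_le i ⟨h, h0, h1⟩ le_rfl) le_add_self
  calc I = ENNReal.ofReal (h ^ ε) * (ENNReal.ofReal (h ^ (-ε)) * I) := by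
        rw [← mul_assoc, ← ENNReal.ofReal_mul (by positivity), ← Real.rpow_add h0]
        simp
    _ ≤ _ := by gcongr

theorem fB_le {δ : ℝ} {γ : (Fin N → ℝ) → ℂ} {a b : ℝ≥0∞}
    (ha : ∀ i, ∫⁻ s, ENNReal.ofReal ((1 + |s i|) ^ δ) * (‖γ s‖₊ : ℝ≥0∞) ≤ a)
    (hb : ∀ i, ∀ h : ℝ, 0 < h → h ≤ 1 →
      ∫⁻ s, (‖γ (s + h • (Pi.single i 1 : Fin N → ℝ)) - γ s‖₊ : ℝ≥0∞) ≤
        ENNReal.ofReal (h ^ δ) * b) :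
    fB N δ γ ≤ a + b := by
  refine add_le_add (iSup_le ha) (iSup_le fun i => iSup_le fun ⟨h, h0, h1⟩ => ?_)
  calc _ ≤ ENNReal.ofReal (h ^ (-δ)) * (ENNReal.ofReal (h ^ δ) * b) := by
        gcongr; exact hb i h h0 h1
    _ = b := by
        rw [← mul_assoc, ← ENNReal.ofReal_mul (by positivity), ← Real.rpow_add h0]
        simp

theorem cons_add_smul_single_zero (t h : ℝ) (y : Fin N → ℝ) :
    (Fin.cons t y : Fin (N + 1) → ℝ) + h • (Pi.single 0 1 : Fin (N + 1) → ℝ) =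
      Fin.cons (t + h) y := by
  ext i
  refine Fin.cases ?_ (fun j => ?_) i <;> simp

/-- The first-variable modulus of `γ`: `L¹`-norms in the remaining variables. -/
theorem isModulus_slices {ε : ℝ} {γ : (Fin (N + 1) → ℝ) → ℂ} (hγ : Measurable γ) :
    IsModulus ε (fB (N + 1) ε γ)
      (fun t => ∫⁻ y : Fin N → ℝ, (‖γ (Fin.cons t y)‖₊ : ℝ≥0∞))
      (fun a b => ∫⁻ y : Fin N → ℝ, (‖γ (Fin.cons a y) - γ (Fin.cons b y)‖₊ : ℝ≥0∞)) := by
  have hc : Measurable fun p : ℝ × (Fin N → ℝ) => γ (Fin.cons p.1 p.2) :=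
    hγ.comp measurable_cons
  have hct : ∀ t : ℝ, Measurable fun y : Fin N → ℝ => γ (Fin.cons t y) := fun t =>
    hc.comp measurable_prodMk_left
  have hcd : ∀ a b : ℝ, Measurable fun y : Fin N → ℝ =>
      (‖γ (Fin.cons a y) - γ (Fin.cons b y)‖₊ : ℝ≥0∞) := fun a b =>
    ((hct a).sub (hct b)).nnnorm.coe_nnreal_ennreal
  refine ⟨?_, ?_, ?_, ?_, ?_, ?_, ?_, ?_⟩
  · exact (hc.nnnorm.coe_nnreal_ennreal).lintegral_prod_right'
  · have : Measurable fun p : (ℝ × ℝ) × (Fin N → ℝ) =>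
        (‖γ (Fin.cons p.1.1 p.2) - γ (Fin.cons p.1.2 p.2)‖₊ : ℝ≥0∞) :=
      ((hc.comp ((measurable_fst.comp measurable_fst).prodMk measurable_snd)).sub
        (hc.comp ((measurable_snd.comp measurable_fst).prodMk
          measurable_snd))).nnnorm.coe_nnreal_ennreal
    exact this.lintegral_prod_right'
  · intro a; simp
  · intro a b; simp only [← enorm_eq_nnnorm, enorm_sub_rev]
  · intro a b c
    rw [← lintegral_add_left (hcd a c)]
    refine lintegral_mono fun y => ?_
    rw [← ENNReal.coe_add, ENNReal.coe_le_coe]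
    simpa using nnnorm_add_le (γ (Fin.cons a y) - γ (Fin.cons c y))
      (γ (Fin.cons c y) - γ (Fin.cons b y))
  · intro a b
    rw [← lintegral_add_left (hct b).nnnorm.coe_nnreal_ennreal]
    refine lintegral_mono fun y => ?_
    rw [← ENNReal.coe_add, ENNReal.coe_le_coe]
    simpa using nnnorm_sub_le (γ (Fin.cons b y)) (γ (Fin.cons b y) - γ (Fin.cons a y))
  · have hm : Measurable fun s : Fin (N + 1) → ℝ =>
        ENNReal.ofReal ((1 + |s 0|) ^ ε) * (‖γ s‖₊ : ℝ≥0∞) := by fun_prop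
    refine le_trans (le_of_eq ?_) (lintegral_weight_le_fB ε γ 0)
    rw [lintegral_eq_lintegral_cons hm]
    refine lintegral_congr fun t => ?_
    simp only [Fin.cons_zero]
    rw [lintegral_const_mul _ (hct t).nnnorm.coe_nnreal_ennreal]
  · intro h h0 h1
    have hm : Measurable fun s : Fin (N + 1) → ℝ =>
        (‖γ (s + h • (Pi.single 0 1 : Fin (N + 1) → ℝ)) - γ s‖₊ : ℝ≥0∞) := by fun_prop
    refine le_trans (le_of_eq ?_) (lintegral_shift_sub_le_fB ε γ 0 h0 h1)
    rw [lintegral_eq_lintegral_cons hm]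
    simp only [cons_add_smul_single_zero]

theorem measurable_J1 {γ : (Fin (N + 1) → ℝ) → ℂ} (hγ : Measurable γ) : Measurable (J1 N γ) :=
  (Complex.measurable_ofReal.comp ((measurable_pi_apply 0).pow_const 2).inv).mul
    (hγ.comp measurable_update_inv)

theorem nnnorm_J1_apply (γ : (Fin (N + 1) → ℝ) → ℂ) (s : Fin (N + 1) → ℝ) :
    (‖J1 N γ s‖₊ : ℝ≥0∞) =
      ENNReal.ofReal (((s 0) ^ 2)⁻¹) * (‖γ (Function.update s 0 (s 0)⁻¹)‖₊ : ℝ≥0∞) := by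
  simp only [J1, ← enorm_eq_nnnorm, enorm_mul]
  congr 1
  rw [← ofReal_norm, Complex.norm_real, Real.norm_of_nonneg (by positivity)]

theorem lintegral_weight_J1 {φ : (Fin (N + 1) → ℝ) → ℝ≥0∞} (hφ : Measurable φ)
    {γ : (Fin (N + 1) → ℝ) → ℂ} (hγ : Measurable γ) :
    ∫⁻ s, φ s * (‖J1 N γ s‖₊ : ℝ≥0∞) =
      ∫⁻ s, φ (Function.update s 0 (s 0)⁻¹) * (‖γ s‖₊ : ℝ≥0∞) := by
  have hm : Measurable fun s : Fin (N + 1) → ℝ =>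
      φ (Function.update s 0 (s 0)⁻¹) * (‖γ s‖₊ : ℝ≥0∞) :=
    (hφ.comp measurable_update_inv).mul hγ.nnnorm.coe_nnreal_ennreal
  rw [← lintegral_inv_sq_mul_comp_update_inv hm]
  refine lintegral_congr fun s => ?_
  rw [nnnorm_J1_apply]
  simp only [Function.update_self, inv_inv, Function.update_idem, Function.update_eq_self]
  ring

theorem integrable_J1 {γ : (Fin (N + 1) → ℝ) → ℂ} (hγ : Measurable γ) (hi : Integrable γ volume) :
    Integrable (J1 N γ) volume := by
  refine ⟨(measurable_J1 hγ).aestronglyMeasurable, ?_⟩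
  have h := lintegral_weight_J1 (φ := fun _ => 1) measurable_const hγ
  simp only [one_mul] at h
  exact h.trans_lt hi.2

theorem lintegral_J1_shift_of_ne_zero {γ : (Fin (N + 1) → ℝ) → ℂ} (hγ : Measurable γ)
    {i : Fin (N + 1)} (hi : i ≠ 0) (h : ℝ) :
    ∫⁻ s, (‖J1 N γ (s + h • (Pi.single i 1 : Fin (N + 1) → ℝ)) - J1 N γ s‖₊ : ℝ≥0∞) =
      ∫⁻ s, (‖γ (s + h • (Pi.single i 1 : Fin (N + 1) → ℝ)) - γ s‖₊ : ℝ≥0∞) := by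
  set v := h • (Pi.single i 1 : Fin (N + 1) → ℝ) with hv
  have hv0 : v 0 = 0 := by simp [hv, hi.symm]
  have hm : Measurable fun s : Fin (N + 1) → ℝ => γ (s + v) - γ s := by fun_prop
  have hJ : ∀ s, J1 N γ (s + v) - J1 N γ s = J1 N (fun s => γ (s + v) - γ s) s := fun s => by
    have : Function.update (s + v) 0 ((s + v) 0)⁻¹ = Function.update s 0 (s 0)⁻¹ + v := by
      ext j
      rcases eq_or_ne j 0 with rfl | hj
      · simp [hv0]
      · simp [hj]
    simp only [J1, this, mul_sub]
    simp [hv0]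
  have key := lintegral_weight_J1 (φ := fun _ => 1) measurable_const hm
  simp only [one_mul] at key
  rw [← key]
  simp only [hJ]

theorem lintegral_J1_shift_zero_le {ε δ : ℝ} (hε : 0 < ε) (hε1 : ε ≤ 1) (hδ : δ ≤ ε / 3)
    {γ : (Fin (N + 1) → ℝ) → ℂ} (hγ : Measurable γ) {h : ℝ} (h0 : 0 < h) (h1 : h ≤ 1) :
    ∫⁻ s, (‖J1 N γ (s + h • (Pi.single 0 1 : Fin (N + 1) → ℝ)) - J1 N γ s‖₊ : ℝ≥0∞) ≤
      128 * (ENNReal.ofReal (h ^ δ) * fB (N + 1) ε γ) := by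
  have hJm := measurable_J1 hγ
  have hm : Measurable fun s : Fin (N + 1) → ℝ =>
      (‖J1 N γ (s + h • (Pi.single 0 1 : Fin (N + 1) → ℝ)) - J1 N γ s‖₊ : ℝ≥0∞) := by fun_prop
  have hct : ∀ t : ℝ, Measurable fun y : Fin N → ℝ => γ (Fin.cons t y) := fun t =>
    (hγ.comp measurable_cons).comp measurable_prodMk_left
  have hcd : ∀ a b : ℝ, Measurable fun y : Fin N → ℝ =>
      (‖γ (Fin.cons a y) - γ (Fin.cons b y)‖₊ : ℝ≥0∞) := fun a b =>
    ((hct a).sub (hct b)).nnnorm.coe_nnreal_ennreal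
  have hn : ∀ a : ℝ, (‖(a : ℂ)‖₊ : ℝ≥0∞) = ENNReal.ofReal |a| := fun a => by
    rw [← enorm_eq_nnnorm, ← ofReal_norm, Complex.norm_real, Real.norm_eq_abs]
  have hn' : ∀ a : ℝ, (‖(((a ^ 2)⁻¹ : ℝ) : ℂ)‖₊ : ℝ≥0∞) = ENNReal.ofReal ((a ^ 2)⁻¹) := fun a => by
    rw [hn, abs_of_nonneg (by positivity)]
  rw [lintegral_eq_lintegral_cons hm]
  refine (isModulus_slices hγ).lintegral_inversion_increment_le hε hε1 hδ h0 h1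
    (fun t => ?_) (fun t => ?_)
  · rw [← lintegral_const_mul _ (hct _).nnnorm.coe_nnreal_ennreal,
      ← lintegral_const_mul _ (hct _).nnnorm.coe_nnreal_ennreal,
      ← lintegral_add_left ((hct _).nnnorm.coe_nnreal_ennreal.const_mul _)]
    refine lintegral_mono fun y => ?_
    simp only [J1, cons_add_smul_single_zero, Fin.cons_zero, Fin.update_cons_zero]
    rw [← hn', ← hn', ← ENNReal.coe_mul, ← ENNReal.coe_mul, ← nnnorm_mul, ← nnnorm_mul,
      ← ENNReal.coe_add, ENNReal.coe_le_coe]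
    exact nnnorm_sub_le _ _
  · rw [← lintegral_const_mul _ (hcd _ _),
      ← lintegral_const_mul _ (hct _).nnnorm.coe_nnreal_ennreal,
      ← lintegral_add_right _ ((hct _).nnnorm.coe_nnreal_ennreal.const_mul _)]
    refine lintegral_mono fun y => ?_
    simp only [J1, cons_add_smul_single_zero, Fin.cons_zero, Fin.update_cons_zero]
    rw [← hn', ← hn, ← ENNReal.coe_mul, ← ENNReal.coe_mul, ← nnnorm_mul, ← nnnorm_mul,
      ← ENNReal.coe_add, ENNReal.coe_le_coe]
    refine le_trans (le_of_eq ?_) (nnnorm_add_le _ _)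
    congr 1
    push_cast
    ring

end Cube

/-- `‖J₁γ‖_{𝔅_δ(ℝ^N)} ≤ C ‖γ‖_{𝔅_ε(ℝ^N)}` for `0 < δ < ε/3`, with `C = C(ε,δ)`
independent of the dimension `N`. -/
theorem statement6 (ε δ : ℝ) (hε0 : 0 < ε) (hε1 : ε ≤ 1) (hδ0 : 0 < δ) (hδ : δ < ε / 3) :
    ∃ C : ℝ, 0 < C ∧ ∀ N : ℕ,
      ∀ γ : (Fin (N + 1) → ℝ) → ℂ, Integrable γ volume → fB (N + 1) ε γ ≠ ⊤ →
        Integrable (J1 N γ) volume ∧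
          fB (N + 1) δ (J1 N γ) ≤ ENNReal.ofReal C * fB (N + 1) ε γ := by
  obtain ⟨C₀, hC₀⟩ :=
    IsModulus.exists_lintegral_inv_weight_le hε0 hε1 hδ0 (by linarith : δ < ε / 2)
  refine ⟨(C₀ + 1) + 128, by positivity, fun N γ₀ hγ₀ _ => ?_⟩
  obtain ⟨γ, hγs, hae⟩ := hγ₀.1
  have hγ := hγs.measurable
  have hγi : Integrable γ volume := hγ₀.congr hae
  rw [fB_congr_ae ε hae, fB_congr_ae δ (J1_congr_ae hae)]
  refine ⟨(integrable_J1 hγ hγi).congr (J1_congr_ae hae).symm, ?_⟩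
  set B := fB (N + 1) ε γ
  have hC : ENNReal.ofReal ((C₀ + 1) + 128) * B = (C₀ + 1) * B + 128 * B := by
    rw [ENNReal.ofReal_add (by positivity) (by positivity),
      ENNReal.ofReal_add (by positivity) (by positivity), ENNReal.ofReal_coe_nnreal, add_mul]
    simp
  rw [hC]
  refine fB_le (fun i => ?_) (fun i h h0 h1 => ?_)
  · have hφ : Measurable fun s : Fin (N + 1) → ℝ => ENNReal.ofReal ((1 + |s i|) ^ δ) := by fun_prop
    rw [lintegral_weight_J1 hφ hγ]
    rcases eq_or_ne i 0 with rfl | hi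
    · have hm : Measurable fun s : Fin (N + 1) → ℝ =>
          ENNReal.ofReal ((1 + |s 0|⁻¹) ^ δ) * (‖γ s‖₊ : ℝ≥0∞) := by fun_prop
      simp only [Function.update_self, abs_inv]
      rw [lintegral_eq_lintegral_cons hm]
      refine le_trans (le_of_eq ?_) ((hC₀ _ _ _ (isModulus_slices hγ)).trans
        (mul_le_mul_left le_self_add _))
      refine lintegral_congr fun t => ?_
      simp only [Fin.cons_zero]
      exact lintegral_const_mul _
        ((hγ.comp measurable_cons).comp measurable_prodMk_left).nnnorm.coe_nnreal_ennreal
    · simp only [Function.update_of_ne hi]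
      calc _ ≤ ∫⁻ s, ENNReal.ofReal ((1 + |s i|) ^ ε) * (‖γ s‖₊ : ℝ≥0∞) := by
            refine lintegral_mono fun s => ?_
            gcongr
            · linarith [abs_nonneg (s i)]
            · linarith
        _ ≤ B := lintegral_weight_le_fB ε γ i
        _ ≤ (C₀ + 1) * B := le_mul_of_one_le_left' le_add_self
  · rcases eq_or_ne i 0 with rfl | hi
    · refine (lintegral_J1_shift_zero_le hε0 hε1 hδ.le hγ h0 h1).trans (le_of_eq ?_)
      ring
    · rw [lintegral_J1_shift_of_ne_zero hγ hi]
      refine (lintegral_shift_sub_le_fB ε γ i h0 h1).trans (mul_le_mul' ?_ ?_)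
      · exact ENNReal.ofReal_le_ofReal
          (Real.rpow_le_rpow_of_exponent_ge h0 h1 (by linarith))
      · exact le_mul_of_one_le_left' (by norm_num)

end
end

section
/- Let N ≥ 1, 1 ≤ i ≤ N and 0 < ε ≤ 1. (a) For every ε' ∈ (0, ε) there is a constant C = C(ε, ε'), independent of N and i, such that for every f ∈ L¹(ℝ^N) with ‖f‖_{𝔅_ε(ℝ^N)} < ∞ and every measurable set E ⊆ ℝ^N: ∫_E |f(x)| dx ≤ C · (λ*(proj_i E))^{ε'} · ‖f‖_{𝔅_ε(ℝ^N)}, where proj_i E := {s ∈ ℝ : s e_i + w ∈ E for some w in the orthogonal complement of e_i} and λ* denotes one-dimensional Lebesgue outer measure. (b) For every δ ∈ (0, ε) there is a constant C = C(ε, δ), independent of N and i, such that ∫_{{x ∈ ℝ^N : |x_i| ≤ 1}} |x_i|^{−δ} |f(x)| dx ≤ C ‖f‖_{𝔅_ε(ℝ^N)}. -/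
open MeasureTheory
open scoped ENNReal NNReal

noncomputable section

/-- The measure `A ↦ ∫_{x_i ∈ A} |f(x)| dx` on the line. -/
def marginal {N : ℕ} (i : Fin N) (f : (Fin N → ℝ) → ℂ) : Measure ℝ :=
  (volume.withDensity fun x => (‖f x‖₊ : ℝ≥0∞)).map fun x => x i

lemma marginal_apply {N : ℕ} (i : Fin N) (f : (Fin N → ℝ) → ℂ) {A : Set ℝ}
    (hA : MeasurableSet A) :
    marginal i f A = ∫⁻ x in (fun x : Fin N → ℝ => x i) ⁻¹' A, (‖f x‖₊ : ℝ≥0∞) := by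
  rw [marginal, Measure.map_apply (measurable_pi_apply i) hA,
    withDensity_apply _ (measurable_pi_apply i hA)]

lemma lintegral_nnnorm_le_fB {N : ℕ} (i : Fin N) {ε : ℝ} (hε : 0 ≤ ε) (f : (Fin N → ℝ) → ℂ) :
    ∫⁻ x, (‖f x‖₊ : ℝ≥0∞) ≤ fB N ε f := by
  refine le_trans ?_ (le_trans (le_iSup (fun i : Fin N => ∫⁻ s : Fin N → ℝ,
      ENNReal.ofReal ((1 + |s i|) ^ ε) * (‖f s‖₊ : ℝ≥0∞)) i) le_self_add)
  refine lintegral_mono fun x => le_mul_of_one_le_left' ?_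
  rw [ENNReal.one_le_ofReal]
  exact Real.one_le_rpow (by linarith [abs_nonneg (x i)]) hε

lemma lintegral_translate_sub_le_fB {N : ℕ} (i : Fin N) {ε : ℝ} (f : (Fin N → ℝ) → ℂ) {h : ℝ}
    (hh : h ∈ Set.Ioc (0 : ℝ) 1) :
    ∫⁻ s : Fin N → ℝ, (‖f (s + h • (Pi.single i 1 : Fin N → ℝ)) - f s‖₊ : ℝ≥0∞) ≤
      ENNReal.ofReal (h ^ ε) * fB N ε f := by
  have key : ENNReal.ofReal (h ^ (-ε)) *
      ∫⁻ s : Fin N → ℝ, (‖f (s + h • (Pi.single i 1 : Fin N → ℝ)) - f s‖₊ : ℝ≥0∞) ≤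
      fB N ε f :=
    le_trans (le_trans (le_iSup (fun h : Set.Ioc (0 : ℝ) 1 => ENNReal.ofReal ((h : ℝ) ^ (-ε)) *
      ∫⁻ s : Fin N → ℝ, (‖f (s + (h : ℝ) • (Pi.single i 1 : Fin N → ℝ)) - f s‖₊ : ℝ≥0∞)) ⟨h, hh⟩)
      (le_iSup (fun i : Fin N => ⨆ h : Set.Ioc (0 : ℝ) 1, ENNReal.ofReal ((h : ℝ) ^ (-ε)) *
      ∫⁻ s : Fin N → ℝ, (‖f (s + (h : ℝ) • (Pi.single i 1 : Fin N → ℝ)) - f s‖₊ : ℝ≥0∞)) i))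
      le_add_self
  calc _ = ENNReal.ofReal (h ^ ε) * (ENNReal.ofReal (h ^ (-ε)) * ∫⁻ s : Fin N → ℝ,
        (‖f (s + h • (Pi.single i 1 : Fin N → ℝ)) - f s‖₊ : ℝ≥0∞)) := by
        rw [← mul_assoc, ← ENNReal.ofReal_mul (by have := hh.1; positivity),
          ← Real.rpow_add hh.1]
        simp
    _ ≤ _ := by gcongr

lemma marginal_le_translate_add {N : ℕ} (i : Fin N) {ε : ℝ} {f : (Fin N → ℝ) → ℂ}
    (hf : AEStronglyMeasurable f volume) {h : ℝ} (hh : h ∈ Set.Ioc (0 : ℝ) 1) {A : Set ℝ}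
    (hA : MeasurableSet A) :
    marginal i f A ≤
      marginal i f ((fun s => s + h) ⁻¹' A) + ENNReal.ofReal (h ^ ε) * fB N ε f := by
  have hA' : MeasurableSet ((fun s => s + h) ⁻¹' A) := measurable_add_const h hA
  set v : Fin N → ℝ := h • (Pi.single i 1 : Fin N → ℝ) with hv
  have hvi : ∀ x : Fin N → ℝ, (x + v) i = x i + h := by intro x; simp [hv]
  rw [marginal_apply i f hA, marginal_apply i f hA']
  set B := (fun x : Fin N → ℝ => x i) ⁻¹' A with hB
  have hBm : MeasurableSet B := measurable_pi_apply i hA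
  have hpre : (fun x : Fin N → ℝ => x i) ⁻¹' ((fun s => s + h) ⁻¹' A) = (fun x => x + v) ⁻¹' B := by
    ext x
    simp only [Set.mem_preimage, hB, hvi]
  have hBm' : MeasurableSet ((fun x => x + v) ⁻¹' B) := measurable_add_const v hBm
  rw [hpre]
  have hshift : ∫⁻ x in B, (‖f x‖₊ : ℝ≥0∞) =
      ∫⁻ x in (fun x => x + v) ⁻¹' B, (‖f (x + v)‖₊ : ℝ≥0∞) := by
    rw [← lintegral_indicator hBm, ← lintegral_indicator hBm',
      ← lintegral_add_right_eq_self (μ := volume) (B.indicator fun x => (‖f x‖₊ : ℝ≥0∞)) v]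
    rfl
  calc _ ≤ ∫⁻ x in (fun x => x + v) ⁻¹' B, ((‖f x‖₊ : ℝ≥0∞) + ‖f (x + v) - f x‖₊) := by
        rw [hshift]
        refine lintegral_mono fun x => ?_
        have : ‖f (x + v)‖₊ ≤ ‖f x‖₊ + ‖f (x + v) - f x‖₊ := by
          simpa using nnnorm_add_le (f x) (f (x + v) - f x)
        rw [← ENNReal.coe_add]
        exact ENNReal.coe_le_coe.2 this
    _ = (∫⁻ x in (fun x => x + v) ⁻¹' B, (‖f x‖₊ : ℝ≥0∞)) +
        ∫⁻ x in (fun x => x + v) ⁻¹' B, (‖f (x + v) - f x‖₊ : ℝ≥0∞) :=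
        lintegral_add_left' hf.enorm.restrict _
    _ ≤ _ := by
        gcongr
        exact (setLIntegral_le_lintegral _ _).trans (lintegral_translate_sub_le_fB i f hh)

/-- Averaging the translates of `A` over `(0, h]` against a finite measure. -/
lemma lintegral_Ioc_measure_translate (ν : Measure ℝ) [IsFiniteMeasure ν] {A : Set ℝ}
    (hA : MeasurableSet A) (h : ℝ) :
    ∫⁻ t in Set.Ioc 0 h, ν ((fun s => s + t) ⁻¹' A) = ∫⁻ u in A, ν (Set.Ico (u - h) u) := by
  have hI : MeasurableSet (Set.Ioc 0 h) := measurableSet_Ioc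
  have hA' : ∀ t : ℝ, MeasurableSet ((fun s => s + t) ⁻¹' A) := fun t => measurable_add_const t hA
  have m1 : Measurable fun p : ℝ × ℝ =>
      (Set.Ioc 0 h).indicator (1 : ℝ → ℝ≥0∞) p.1 * A.indicator (1 : ℝ → ℝ≥0∞) (p.2 + p.1) :=
    ((measurable_one.indicator hI).comp measurable_fst).mul
      ((measurable_one.indicator hA).comp (measurable_snd.add measurable_fst))
  have m2 : Measurable fun p : ℝ × ℝ =>
      (Set.Ioc 0 h).indicator (1 : ℝ → ℝ≥0∞) (p.2 - p.1) * A.indicator (1 : ℝ → ℝ≥0∞) p.2 :=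
    ((measurable_one.indicator hI).comp (measurable_snd.sub measurable_fst)).mul
      ((measurable_one.indicator hA).comp measurable_snd)
  calc _ = ∫⁻ t, ∫⁻ s, (Set.Ioc 0 h).indicator (1 : ℝ → ℝ≥0∞) t *
        A.indicator (1 : ℝ → ℝ≥0∞) (s + t) ∂ν := by
        rw [← lintegral_indicator hI]
        refine lintegral_congr fun t => ?_
        have hmeas : Measurable fun s : ℝ => A.indicator (1 : ℝ → ℝ≥0∞) (s + t) :=
          (measurable_one.indicator hA).comp (measurable_add_const t)
        rw [lintegral_const_mul _ hmeas]
        have : ∫⁻ s, A.indicator (1 : ℝ → ℝ≥0∞) (s + t) ∂ν = ν ((fun s => s + t) ⁻¹' A) := by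
          rw [← lintegral_indicator_one (hA' t)]
          rfl
        rw [this]
        by_cases ht : t ∈ Set.Ioc 0 h <;> simp only [Set.indicator, ht] <;> simp
    _ = ∫⁻ s, (∫⁻ t, (Set.Ioc 0 h).indicator (1 : ℝ → ℝ≥0∞) t *
        A.indicator (1 : ℝ → ℝ≥0∞) (s + t)) ∂ν := lintegral_lintegral_swap m1.aemeasurable
    _ = ∫⁻ s, (∫⁻ u, (Set.Ioc 0 h).indicator (1 : ℝ → ℝ≥0∞) (u - s) *
        A.indicator (1 : ℝ → ℝ≥0∞) u) ∂ν := by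
        refine lintegral_congr fun s => ?_
        rw [← lintegral_add_left_eq_self (μ := volume) (fun u =>
          (Set.Ioc 0 h).indicator (1 : ℝ → ℝ≥0∞) (u - s) * A.indicator (1 : ℝ → ℝ≥0∞) u) s]
        simp
    _ = ∫⁻ u, ∫⁻ s, (Set.Ioc 0 h).indicator (1 : ℝ → ℝ≥0∞) (u - s) *
        A.indicator (1 : ℝ → ℝ≥0∞) u ∂ν := lintegral_lintegral_swap m2.aemeasurable
    _ = _ := by
        rw [← lintegral_indicator hA]
        refine lintegral_congr fun u => ?_
        have hmeas : Measurable fun s : ℝ => (Set.Ioc 0 h).indicator (1 : ℝ → ℝ≥0∞) (u - s) :=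
          (measurable_one.indicator hI).comp (measurable_const_sub u)
        rw [lintegral_mul_const _ hmeas]
        have : ∫⁻ s, (Set.Ioc 0 h).indicator (1 : ℝ → ℝ≥0∞) (u - s) ∂ν = ν (Set.Ico (u - h) u) := by
          rw [← lintegral_indicator_one measurableSet_Ico]
          refine lintegral_congr fun s => ?_
          have : u - s ∈ Set.Ioc 0 h ↔ s ∈ Set.Ico (u - h) u := by
            simp only [Set.mem_Ioc, Set.mem_Ico]
            constructor <;> rintro ⟨_, _⟩ <;> constructor <;> linarith
          simp only [Set.indicator, this]
          simp
        rw [this]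
        by_cases hu : u ∈ A <;> simp [Set.indicator, hu]

section TranslationRegular

variable {ν : Measure ℝ} [IsFiniteMeasure ν] {ε ε' M C : ℝ}

lemma measureReal_Ico_le (hε : ε' < ε) (hε' : 0 < ε') (huniv : ν.real Set.univ ≤ M)
    (hshift : ∀ h ∈ Set.Ioc (0 : ℝ) 1, ∀ A, MeasurableSet A →
      ν.real A ≤ ν.real ((fun s => s + h) ⁻¹' A) + h ^ ε * M)
    (hC : 2 ≤ C) (hC' : C * 2 ^ ε' + 1 ≤ 2 * C) {h : ℝ} (hh : h ∈ Set.Ioc (0 : ℝ) 1) (u : ℝ) :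
    ν.real (Set.Ico (u - h) u) ≤ C * h ^ ε' * M := by
  have hM : 0 ≤ M := measureReal_nonneg.trans huniv
  obtain ⟨k, hk⟩ := exists_pow_lt_of_lt_one hh.1 (by norm_num : (1 / 2 : ℝ) < 1)
  induction k generalizing h u with
  | zero => exact absurd hk (by simpa using hh.2)
  | succ k ih =>
    have h0 := hh.1
    have hpow : 0 < h ^ ε' := Real.rpow_pos_of_pos h0 _
    rcases le_or_gt (2 * h) 1 with h2 | h2
    · have H := ih (h := 2 * h) ⟨by linarith, h2⟩ u (by rw [pow_succ] at hk; linarith)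
      rw [Real.mul_rpow (by norm_num) h0.le] at H
      have S := hshift h hh (Set.Ico (u - h) u) measurableSet_Ico
      have hpre : (fun s => s + h) ⁻¹' Set.Ico (u - h) u = Set.Ico (u - 2 * h) (u - h) := by
        rw [Set.preimage_add_const_Ico]
        congr 1
        ring
      rw [hpre] at S
      have U : ν.real (Set.Ico (u - 2 * h) u) =
          ν.real (Set.Ico (u - 2 * h) (u - h)) + ν.real (Set.Ico (u - h) u) := by
        rw [← Set.Ico_union_Ico_eq_Ico (b := u - h) (by linarith) (by linarith)]
        exact measureReal_union (Set.Ico_disjoint_Ico_same) measurableSet_Ico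
      have P : h ^ ε * M ≤ h ^ ε' * M :=
        mul_le_mul_of_nonneg_right (Real.rpow_le_rpow_of_exponent_ge h0 hh.2 hε.le) hM
      have Q := mul_le_mul_of_nonneg_right hC' (mul_nonneg hpow.le hM)
      linarith
    · have h3 : 1 ≤ 2 * h ^ ε' := by
        have e1 : (1 : ℝ) ≤ (2 * h) ^ ε' := Real.one_le_rpow h2.le hε'.le
        rw [Real.mul_rpow (by norm_num) h0.le] at e1
        have e2 : (2 : ℝ) ^ ε' ≤ 2 :=
          le_of_mul_le_mul_left (by linarith : C * 2 ^ ε' ≤ C * 2) (by linarith)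
        nlinarith
      have h4 : 1 ≤ C * h ^ ε' := h3.trans (mul_le_mul_of_nonneg_right hC hpow.le)
      calc _ ≤ M := (measureReal_mono (Set.subset_univ _)).trans huniv
        _ ≤ _ := le_mul_of_one_le_left hM h4

lemma measureReal_le_of_volume_le (hε : ε' < ε) (hε' : 0 < ε') (huniv : ν.real Set.univ ≤ M)
    (hshift : ∀ h ∈ Set.Ioc (0 : ℝ) 1, ∀ A, MeasurableSet A →
      ν.real A ≤ ν.real ((fun s => s + h) ⁻¹' A) + h ^ ε * M)
    (hC : 2 ≤ C) (hC' : C * 2 ^ ε' + 1 ≤ 2 * C) {h : ℝ} (hh : h ∈ Set.Ioc (0 : ℝ) 1)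
    {A : Set ℝ} (hA : MeasurableSet A) (hAh : volume A ≤ ENNReal.ofReal h) :
    ν.real A ≤ (C + 1) * h ^ ε' * M := by
  have hM : 0 ≤ M := measureReal_nonneg.trans huniv
  have h0 := hh.1
  have hpow : 0 < h ^ ε' := Real.rpow_pos_of_pos h0 _
  have P : h ^ ε * M ≤ h ^ ε' * M :=
    mul_le_mul_of_nonneg_right (Real.rpow_le_rpow_of_exponent_ge h0 hh.2 hε.le) hM
  have upper : ∫⁻ u in A, ν (Set.Ico (u - h) u) ≤ ENNReal.ofReal (C * h ^ ε' * M * h) := by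
    calc _ ≤ ∫⁻ u in A, ENNReal.ofReal (C * h ^ ε' * M) := by
          refine lintegral_mono fun u => ?_
          rw [← ofReal_measureReal]
          exact ENNReal.ofReal_le_ofReal (measureReal_Ico_le hε hε' huniv hshift hC hC' hh u)
      _ ≤ _ := by
          rw [setLIntegral_const, ENNReal.ofReal_mul (p := C * h ^ ε' * M) (by positivity)]
          gcongr
  have lower : ENNReal.ofReal ((ν.real A - h ^ ε' * M) * h) ≤
      ∫⁻ t in Set.Ioc 0 h, ν ((fun s => s + t) ⁻¹' A) := by
    calc _ = ∫⁻ t in Set.Ioc 0 h, ENNReal.ofReal (ν.real A - h ^ ε' * M) := by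
          rw [setLIntegral_const, Real.volume_Ioc, sub_zero, ENNReal.ofReal_mul' h0.le]
      _ ≤ _ := by
          refine setLIntegral_mono' measurableSet_Ioc fun t ht => ?_
          rw [← ofReal_measureReal]
          refine ENNReal.ofReal_le_ofReal ?_
          have S := hshift t ⟨ht.1, ht.2.trans hh.2⟩ A hA
          have T : t ^ ε * M ≤ h ^ ε * M :=
            mul_le_mul_of_nonneg_right (Real.rpow_le_rpow ht.1.le ht.2 (by linarith)) hM
          linarith
  rw [lintegral_Ioc_measure_translate ν hA] at lower
  have key := (ENNReal.ofReal_le_ofReal_iff (by positivity)).1 (lower.trans upper)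
  have := le_of_mul_le_mul_right key h0
  linarith

lemma measureReal_le_rpow_volume (hε : ε' < ε) (hε' : 0 < ε') (huniv : ν.real Set.univ ≤ M)
    (hshift : ∀ h ∈ Set.Ioc (0 : ℝ) 1, ∀ A, MeasurableSet A →
      ν.real A ≤ ν.real ((fun s => s + h) ⁻¹' A) + h ^ ε * M)
    (hC : 2 ≤ C) (hC' : C * 2 ^ ε' + 1 ≤ 2 * C) {A : Set ℝ} (hA : MeasurableSet A)
    (hAfin : volume A ≠ ⊤) :
    ν.real A ≤ (C + 1) * volume.real A ^ ε' * M := by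
  have hM : 0 ≤ M := measureReal_nonneg.trans huniv
  rcases le_or_gt (volume.real A) 1 with h1 | h1
  · rcases (measureReal_nonneg (μ := volume) (s := A)).eq_or_lt with h0 | h0
    · rw [← h0, Real.zero_rpow hε'.ne', mul_zero, zero_mul]
      have lim : Filter.Tendsto (fun h : ℝ => (C + 1) * h ^ ε' * M) (nhdsWithin 0 (Set.Ioi 0))
          (nhds ((C + 1) * 0 ^ ε' * M)) :=
        (((Real.continuousAt_rpow_const 0 ε' (Or.inr hε'.le)).tendsto.const_mul _).mul_const
          _).mono_left nhdsWithin_le_nhds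
      rw [Real.zero_rpow hε'.ne', mul_zero, zero_mul] at lim
      refine ge_of_tendsto lim ?_
      filter_upwards [Ioc_mem_nhdsGT (zero_lt_one' ℝ)] with h hh
      refine measureReal_le_of_volume_le hε hε' huniv hshift hC hC' hh hA ?_
      rw [← ofReal_measureReal hAfin, ← h0]
      exact ENNReal.ofReal_le_ofReal hh.1.le
    · exact measureReal_le_of_volume_le hε hε' huniv hshift hC hC' ⟨h0, h1⟩ hA
        (ofReal_measureReal hAfin).ge
  · calc _ ≤ M := (measureReal_mono (Set.subset_univ _)).trans huniv
      _ ≤ _ := le_mul_of_one_le_left hM (one_le_mul_of_one_le_of_one_le (by linarith)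
          (Real.one_le_rpow h1.le hε'.le))

end TranslationRegular

/-- A constant depending only on the exponent, bounding the marginal in terms of volume. -/
def marginalConst (ε' : ℝ) : ℝ := 3 + 1 / (2 - 2 ^ ε')

lemma two_sub_rpow_pos {ε' : ℝ} (h1 : ε' < 1) : 0 < 2 - (2 : ℝ) ^ ε' := by
  have := Real.rpow_lt_rpow_of_exponent_lt (by norm_num : (1 : ℝ) < 2) h1
  rw [Real.rpow_one] at this
  linarith

lemma marginalConst_pos {ε' : ℝ} (h1 : ε' < 1) : 0 < marginalConst ε' := by
  have := two_sub_rpow_pos h1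
  unfold marginalConst
  positivity

lemma marginal_le_fB {N : ℕ} (i : Fin N) {ε : ℝ} (hε : 0 ≤ ε) (f : (Fin N → ℝ) → ℂ)
    (A : Set ℝ) : marginal i f A ≤ fB N ε f := by
  refine (measure_mono (Set.subset_univ A)).trans ?_
  rw [marginal_apply i f MeasurableSet.univ, Set.preimage_univ, setLIntegral_univ]
  exact lintegral_nnnorm_le_fB i hε f

lemma marginal_le_rpow_volume {ε ε' : ℝ} (hε1 : ε ≤ 1) (hε' : 0 < ε') (hε : ε' < ε) {N : ℕ}
    (i : Fin N) {f : (Fin N → ℝ) → ℂ} (hf : AEStronglyMeasurable f volume)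
    (hfin : fB N ε f ≠ ⊤) {A : Set ℝ} (hA : MeasurableSet A) :
    marginal i f A ≤ ENNReal.ofReal (marginalConst ε') * volume A ^ ε' * fB N ε f := by
  have hle := marginal_le_fB i (hε'.trans hε).le f
  have hp := two_sub_rpow_pos (hε.trans_le hε1)
  have hcpos := marginalConst_pos (hε.trans_le hε1)
  by_cases hAfin : volume A = ⊤
  · rw [hAfin, ENNReal.top_rpow_of_pos hε', ENNReal.mul_top (by simpa using hcpos)]
    rcases eq_or_ne (fB N ε f) 0 with h0 | h0
    · simpa [h0] using hle A
    · simp [ENNReal.top_mul h0]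
  have : IsFiniteMeasure (marginal i f) := ⟨(hle _).trans_lt hfin.lt_top⟩
  have hreal : ∀ B, (marginal i f).real B ≤ (fB N ε f).toReal :=
    fun B => ENNReal.toReal_mono hfin (hle B)
  have hshift : ∀ h ∈ Set.Ioc (0 : ℝ) 1, ∀ B, MeasurableSet B → (marginal i f).real B ≤
      (marginal i f).real ((fun s => s + h) ⁻¹' B) + h ^ ε * (fB N ε f).toReal := by
    intro h hh B hB
    have hhp : 0 ≤ h ^ ε := Real.rpow_nonneg hh.1.le _
    have := ENNReal.toReal_mono (by finiteness) (marginal_le_translate_add (ε := ε) i hf hh hB)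
    rwa [ENNReal.toReal_add (by finiteness) (by finiteness), ENNReal.toReal_mul,
      ENNReal.toReal_ofReal hhp] at this
  have key := measureReal_le_rpow_volume (C := 2 + 1 / (2 - 2 ^ ε')) hε hε' (hreal _) hshift
    (by simpa using hp.le) (by
      have : 1 / (2 - (2 : ℝ) ^ ε') * (2 - 2 ^ ε') = 1 := by field_simp
      nlinarith) hA hAfin
  rw [← ofReal_measureReal (μ := marginal i f)]
  refine (ENNReal.ofReal_le_ofReal key).trans_eq ?_
  rw [ENNReal.ofReal_mul' ENNReal.toReal_nonneg, ENNReal.ofReal_mul' (by positivity),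
    ENNReal.ofReal_toReal hfin, ← ENNReal.ofReal_rpow_of_nonneg measureReal_nonneg hε'.le,
    ofReal_measureReal hAfin, marginalConst]
  ring_nf

/-- Dyadic domination of the singular weight `|s|^{-δ}` on `[-1, 1]`. -/
lemma ofReal_abs_rpow_neg_le_tsum {δ : ℝ} (hδ : 0 < δ) {s : ℝ} (hs : |s| ≤ 1) :
    ENNReal.ofReal (|s| ^ (-δ)) ≤ ∑' k : ℕ,
      (Metric.closedBall (0 : ℝ) ((1 / 2) ^ k)).indicator
        (fun _ => ENNReal.ofReal (((1 / 2 : ℝ) ^ (k + 1)) ^ (-δ))) s := by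
  rcases (abs_nonneg s).eq_or_lt with h0 | h0
  · simp [← h0, Real.zero_rpow (neg_ne_zero.2 hδ.ne')]
  obtain ⟨k, hk1, hk2⟩ := exists_nat_pow_near_of_lt_one h0 hs (by norm_num : (0 : ℝ) < 1 / 2)
    (by norm_num)
  refine le_trans ?_ (ENNReal.le_tsum k)
  rw [Set.indicator_of_mem (by simpa using hk2)]
  exact ENNReal.ofReal_le_ofReal
    (Real.rpow_le_rpow_of_nonpos (by positivity) hk1.le (by linarith))

lemma setLIntegral_abs_rpow_neg_mul {N : ℕ} (i : Fin N) {f : (Fin N → ℝ) → ℂ}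
    (hf : AEStronglyMeasurable f volume) (δ : ℝ) :
    (∫⁻ x in {x : Fin N → ℝ | |x i| ≤ 1}, ENNReal.ofReal (|x i| ^ (-δ)) * (‖f x‖₊ : ℝ≥0∞)) =
      ∫⁻ s in Set.Icc (-1) 1, ENNReal.ofReal (|s| ^ (-δ)) ∂(marginal i f) := by
  have hm : Measurable fun s : ℝ => ENNReal.ofReal (|s| ^ (-δ)) := by fun_prop
  have hfm : AEMeasurable (fun x => (‖f x‖₊ : ℝ≥0∞)) volume := hf.enorm
  have hi : Measurable fun x : Fin N → ℝ => x i := measurable_pi_apply i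
  have hset : {x : Fin N → ℝ | |x i| ≤ 1} = (fun x => x i) ⁻¹' Set.Icc (-1) 1 := by
    ext x
    simp [abs_le]
  rw [marginal, setLIntegral_map measurableSet_Icc hm hi, hset,
    restrict_withDensity (hi measurableSet_Icc),
    lintegral_withDensity_eq_lintegral_mul₀ (g := fun x => ENNReal.ofReal (|x i| ^ (-δ)))
      hfm.restrict (hm.comp hi).aemeasurable]
  exact lintegral_congr fun x => mul_comm _ _

lemma lintegral_abs_rpow_neg_le_tsum {δ : ℝ} (hδ : 0 < δ) (ν : Measure ℝ) :
    ∫⁻ s in Set.Icc (-1) 1, ENNReal.ofReal (|s| ^ (-δ)) ∂ν ≤ ∑' k : ℕ,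
      ENNReal.ofReal (((1 / 2 : ℝ) ^ (k + 1)) ^ (-δ)) *
        ν (Metric.closedBall (0 : ℝ) ((1 / 2) ^ k)) := by
  calc _ ≤ ∫⁻ s, ∑' k : ℕ, (Metric.closedBall (0 : ℝ) ((1 / 2) ^ k)).indicator
        (fun _ => ENNReal.ofReal (((1 / 2 : ℝ) ^ (k + 1)) ^ (-δ))) s ∂ν :=
        (setLIntegral_mono' measurableSet_Icc fun s hs =>
          ofReal_abs_rpow_neg_le_tsum hδ (abs_le.2 hs)).trans (setLIntegral_le_lintegral _ _)
    _ = _ := by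
        rw [lintegral_tsum fun k =>
          (measurable_const.indicator Metric.isClosed_closedBall.measurableSet).aemeasurable]
        refine tsum_congr fun k => ?_
        rw [lintegral_indicator_const Metric.isClosed_closedBall.measurableSet]

lemma dyadic_weight_mul_rpow {δ ε' : ℝ} (k : ℕ) :
    ((1 / 2 : ℝ) ^ (k + 1)) ^ (-δ) * (2 * (1 / 2) ^ k) ^ ε' =
      (2 ^ δ * 2 ^ ε') * ((1 / 2) ^ (ε' - δ)) ^ k := by
  have h2 : (0 : ℝ) < 1 / 2 := by norm_num
  have e : ((2 : ℝ) ^ δ) = (1 / 2 : ℝ) ^ (-δ) := by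
    rw [one_div, Real.inv_rpow (by norm_num), Real.rpow_neg (by norm_num), inv_inv]
  rw [pow_succ, Real.mul_rpow (by positivity) h2.le, Real.mul_rpow (by norm_num) (by positivity), e,
    ← Real.rpow_natCast (1 / 2 : ℝ) k, ← Real.rpow_natCast _ k, ← Real.rpow_mul h2.le,
    ← Real.rpow_mul h2.le, ← Real.rpow_mul h2.le,
    show (ε' - δ) * (k : ℝ) = k * -δ + k * ε' by ring, Real.rpow_add h2]
  ring

/-- (a) `∫_E |f| ≤ C (λ*(proj_i E))^{ε'} ‖f‖_{𝔅_ε}` for measurable `E`, where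
`proj_i E` is the projection of `E` onto the `i`-th coordinate axis and `λ*` denotes
one-dimensional Lebesgue outer measure; (b) `∫_{|x_i| ≤ 1} |x_i|^{−δ} |f(x)| dx ≤ C ‖f‖_{𝔅_ε}`.
In both parts the constant is independent of `N` and of `i`. -/
theorem statement9 (ε : ℝ) (hε0 : 0 < ε) (hε1 : ε ≤ 1) :
    (∀ ε' : ℝ, 0 < ε' → ε' < ε → ∃ C : ℝ, 0 < C ∧
      ∀ (N : ℕ) (i : Fin N) (f : (Fin N → ℝ) → ℂ),
        Integrable f volume → fB N ε f ≠ ⊤ →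
        ∀ E : Set (Fin N → ℝ), MeasurableSet E →
          (∫⁻ x in E, (‖f x‖₊ : ℝ≥0∞)) ≤
            ENNReal.ofReal C * (volume ((fun x : Fin N → ℝ => x i) '' E)) ^ ε' *
              fB N ε f) ∧
    (∀ δ : ℝ, 0 < δ → δ < ε → ∃ C : ℝ, 0 < C ∧
      ∀ (N : ℕ) (i : Fin N) (f : (Fin N → ℝ) → ℂ),
        Integrable f volume → fB N ε f ≠ ⊤ →
        (∫⁻ x in {x : Fin N → ℝ | |x i| ≤ 1},
            ENNReal.ofReal (|x i| ^ (-δ)) * (‖f x‖₊ : ℝ≥0∞)) ≤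
          ENNReal.ofReal C * fB N ε f) := by
  refine ⟨fun ε' h0 h1 => ⟨marginalConst ε', marginalConst_pos (h1.trans_le hε1),
    fun N i f hf hfin E _ => ?_⟩, fun δ h0 h1 => ?_⟩
  · set P := (fun x : Fin N → ℝ => x i) '' E
    have hP : MeasurableSet (toMeasurable volume P) := measurableSet_toMeasurable _ _
    have := marginal_le_rpow_volume hε1 h0 h1 i hf.1 hfin hP
    rw [measure_toMeasurable, marginal_apply i f hP] at this
    refine (lintegral_mono_set fun x hx => ?_).trans this
    exact subset_toMeasurable _ _ (Set.mem_image_of_mem _ hx)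
  · obtain ⟨ε', hδ', hε'⟩ := exists_between h1
    have hc := marginalConst_pos (hε'.trans_le hε1)
    have hr0 : (0 : ℝ) < (1 / 2) ^ (ε' - δ) := by positivity
    have hr1 : ((1 / 2 : ℝ)) ^ (ε' - δ) < 1 :=
      Real.rpow_lt_one (by norm_num) (by norm_num) (by linarith)
    set r : ℝ := (1 / 2) ^ (ε' - δ) with hr
    have hsub : 0 < 1 - r := by linarith
    refine ⟨marginalConst ε' * (2 ^ δ * 2 ^ ε' * (1 - r)⁻¹), by positivity,
      fun N i f hf hfin => ?_⟩
    rw [setLIntegral_abs_rpow_neg_mul i hf.1]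
    refine (lintegral_abs_rpow_neg_le_tsum h0 _).trans ?_
    calc _ ≤ ∑' k : ℕ, ENNReal.ofReal ((2 ^ δ * 2 ^ ε') * r ^ k) *
          (ENNReal.ofReal (marginalConst ε') * fB N ε f) := by
          refine ENNReal.tsum_le_tsum fun k => ?_
          have hk := marginal_le_rpow_volume hε1 (h0.trans hδ') hε' i hf.1 hfin
            (Metric.isClosed_closedBall (x := (0 : ℝ)) (ε := (1 / 2) ^ k)).measurableSet
          rw [Real.volume_closedBall, ENNReal.ofReal_rpow_of_nonneg (by positivity)
            (h0.trans hδ').le] at hk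
          refine (mul_le_mul_right hk _).trans_eq ?_
          rw [hr, ← dyadic_weight_mul_rpow, ENNReal.ofReal_mul (by positivity)]
          ring
      _ = _ := by
          rw [ENNReal.tsum_mul_right, ← ENNReal.ofReal_tsum_of_nonneg (fun k => by positivity)
            ((summable_geometric_of_lt_one hr0.le hr1).mul_left _), tsum_mul_left,
            tsum_geometric_of_lt_one hr0.le hr1, ENNReal.ofReal_mul hc.le]
          ring

end
end

section
/- Let n, d ≥ 1 and ε > 0. There exist δ = δ(ε, d) > 0 and C = C(ε, d), both independent of n, such that for every ς ∈ L¹(ℝ^n×ℝ^d) with ‖ς‖_{ℬ_ε} < ∞: ∬_{ℝ^n×ℝ^d} |v|^{−δ} |ς(α, v)| dα dv ≤ C ‖ς‖_{ℬ_ε}. -/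
open MeasureTheory
open scoped ENNReal NNReal

noncomputable section

abbrev Rd (d : ℕ) : Type := EuclideanSpace ℝ (Fin d)

/-- The norm `‖ς‖_{ℬ_ε}`. -/
noncomputable def Bnorm (n d : ℕ) (ε : ℝ) (ς : (Fin n → ℝ) × Rd d → ℂ) : ℝ≥0∞ :=
  (⨆ i : Fin n, ∫⁻ p : (Fin n → ℝ) × Rd d,
      ENNReal.ofReal ((1 + |p.1 i|) ^ ε) * (‖ς p‖₊ : ℝ≥0∞)) +
  (⨆ i : Fin n, ⨆ h : Set.Ioc (0 : ℝ) 1,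
      ENNReal.ofReal ((h : ℝ) ^ (-ε)) *
        ∫⁻ p : (Fin n → ℝ) × Rd d,
          (‖ς (p.1 + (h : ℝ) • (Pi.single i 1 : Fin n → ℝ), p.2) - ς p‖₊ : ℝ≥0∞)) +
  (⨆ h : {h : Rd d // 0 < ‖h‖ ∧ ‖h‖ ≤ 1},
      ENNReal.ofReal (‖(h : Rd d)‖ ^ (-ε)) *
        ∫⁻ p : (Fin n → ℝ) × Rd d, (‖ς (p.1, p.2 + (h : Rd d)) - ς p‖₊ : ℝ≥0∞)) +
  ∫⁻ p : (Fin n → ℝ) × Rd d, ENNReal.ofReal ((1 + ‖p.2‖) ^ ε) * (‖ς p‖₊ : ℝ≥0∞)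

lemma lintegral_nnnorm_le_Bnorm {n d : ℕ} {s : ℝ} (hs : 0 ≤ s) (ς : (Fin n → ℝ) × Rd d → ℂ) :
    ∫⁻ p, (‖ς p‖₊ : ℝ≥0∞) ≤ Bnorm n d s ς := by
  refine le_trans (lintegral_mono fun p => ?_) le_add_self
  refine le_mul_of_one_le_left zero_le ?_
  rw [ENNReal.one_le_ofReal]
  exact Real.one_le_rpow (by linarith [norm_nonneg p.2]) hs

lemma lintegral_translate_sub_le_Bnorm {n d : ℕ} {s : ℝ} (ς : (Fin n → ℝ) × Rd d → ℂ)
    {h : Rd d} (h0 : 0 < ‖h‖) (h1 : ‖h‖ ≤ 1) :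
    ∫⁻ p : (Fin n → ℝ) × Rd d, (‖ς (p.1, p.2 + h) - ς p‖₊ : ℝ≥0∞) ≤
      ENNReal.ofReal (‖h‖ ^ s) * Bnorm n d s ς := by
  have key : ENNReal.ofReal (‖h‖ ^ (-s)) *
      ∫⁻ p : (Fin n → ℝ) × Rd d, (‖ς (p.1, p.2 + h) - ς p‖₊ : ℝ≥0∞) ≤ Bnorm n d s ς := by
    refine le_trans ?_ (le_trans le_add_self le_self_add)
    exact le_iSup (fun h : {h : Rd d // 0 < ‖h‖ ∧ ‖h‖ ≤ 1} =>
      ENNReal.ofReal (‖(h : Rd d)‖ ^ (-s)) *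
        ∫⁻ p : (Fin n → ℝ) × Rd d, (‖ς (p.1, p.2 + (h : Rd d)) - ς p‖₊ : ℝ≥0∞)) ⟨h, h0, h1⟩
  refine le_trans (le_of_eq ?_) (mul_le_mul_right key _)
  rw [← mul_assoc, ← ENNReal.ofReal_mul (by positivity), ← Real.rpow_add h0]
  simp

/-- Translating a slab by `h` costs at most the `L¹` modulus of continuity. -/
lemma setLIntegral_closedBall_le_translate {n d : ℕ} {ς : (Fin n → ℝ) × Rd d → ℂ}
    (hς : AEStronglyMeasurable ς volume) (h : Rd d) (r : ℝ) :
    ∫⁻ p in Prod.snd ⁻¹' Metric.closedBall 0 r, (‖ς p‖₊ : ℝ≥0∞) ≤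
      (∫⁻ p in Prod.snd ⁻¹' Metric.closedBall h r, (‖ς p‖₊ : ℝ≥0∞)) +
        ∫⁻ p : (Fin n → ℝ) × Rd d, (‖ς (p.1, p.2 + h) - ς p‖₊ : ℝ≥0∞) := by
  have : (volume : Measure ((Fin n → ℝ) × Rd d)).IsAddRightInvariant :=
    inferInstanceAs ((volume : Measure (Fin n → ℝ)).prod
      (volume : Measure (Rd d))).IsAddRightInvariant
  have hmp : MeasurePreserving (fun p : (Fin n → ℝ) × Rd d => p + (0, h)) volume volume :=
    measurePreserving_add_right volume (0, h)
  have hadd : ∀ p : (Fin n → ℝ) × Rd d, p + (0, h) = (p.1, p.2 + h) := fun p => by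
    ext <;> simp
  have hpre : (fun p : (Fin n → ℝ) × Rd d => p + (0, h)) ⁻¹'
      (Prod.snd ⁻¹' Metric.closedBall h r) = Prod.snd ⁻¹' Metric.closedBall 0 r := by
    ext p
    simp [dist_eq_norm]
  have hshift : ∫⁻ p in Prod.snd ⁻¹' Metric.closedBall h r, (‖ς p‖₊ : ℝ≥0∞) =
      ∫⁻ p in Prod.snd ⁻¹' Metric.closedBall 0 r, (‖ς (p.1, p.2 + h)‖₊ : ℝ≥0∞) := by
    rw [← hpre, ← hmp.setLIntegral_comp_preimage_emb
      (MeasurableEquiv.addRight ((0, h) : (Fin n → ℝ) × Rd d)).measurableEmbedding]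
    simp only [hadd]
  have hm : AEStronglyMeasurable (fun p : (Fin n → ℝ) × Rd d => ς (p.1, p.2 + h)) volume := by
    simpa only [Function.comp_def, hadd] using hς.comp_measurePreserving hmp
  rw [hshift]
  calc _ ≤ ∫⁻ p in Prod.snd ⁻¹' Metric.closedBall 0 r,
        ((‖ς (p.1, p.2 + h)‖₊ : ℝ≥0∞) + (‖ς (p.1, p.2 + h) - ς p‖₊ : ℝ≥0∞)) := by
        refine lintegral_mono fun p => ?_
        rw [← ENNReal.coe_add, ENNReal.coe_le_coe]
        exact nnnorm_le_insert _ _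
    _ = _ := lintegral_add_left' hm.enorm.restrict _
    _ ≤ _ := add_le_add le_rfl (setLIntegral_le_lintegral _ _)

lemma nsmul_setLIntegral_closedBall_le {n d : ℕ} (hd : 1 ≤ d) {s : ℝ} (hs : 0 < s)
    {ς : (Fin n → ℝ) × Rd d → ℂ} (hς : AEStronglyMeasurable ς volume) {r : ℝ} (hr : 0 < r)
    (m : ℕ) (hm : 3 * r * m ≤ 1) :
    m * ∫⁻ p in Prod.snd ⁻¹' Metric.closedBall 0 r, (‖ς p‖₊ : ℝ≥0∞) ≤
      Bnorm n d s ς + m * (ENNReal.ofReal ((3 * r * m) ^ s) * Bnorm n d s ς) := by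
  set e : Rd d := EuclideanSpace.single ⟨0, hd⟩ 1
  have he : ‖e‖ = 1 := by simp [e]
  set c : ℕ → Rd d := fun j => (3 * r * j) • e
  have hc : ∀ j, ‖c j‖ = 3 * r * j := fun j => by
    simp only [c, norm_smul, he, mul_one, Real.norm_eq_abs]
    exact abs_of_nonneg (by positivity)
  have hstep : ∀ j ∈ Finset.Icc 1 m,
      ∫⁻ p in Prod.snd ⁻¹' Metric.closedBall 0 r, (‖ς p‖₊ : ℝ≥0∞) ≤
        (∫⁻ p in Prod.snd ⁻¹' Metric.closedBall (c j) r, (‖ς p‖₊ : ℝ≥0∞)) +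
          ENNReal.ofReal ((3 * r * m) ^ s) * Bnorm n d s ς := fun j hj => by
    rw [Finset.mem_Icc] at hj
    have hj1 : (1 : ℝ) ≤ j := by exact_mod_cast hj.1
    have hjm : (j : ℝ) ≤ m := by exact_mod_cast hj.2
    have hle : 3 * r * j ≤ 3 * r * m := by gcongr
    refine (setLIntegral_closedBall_le_translate hς (c j) r).trans ?_
    gcongr
    refine (lintegral_translate_sub_le_Bnorm (s := s) ς ?_ ?_).trans ?_
    · rw [hc]; positivity
    · rw [hc]; linarith
    · rw [hc]; gcongr
  have hdisj : Set.PairwiseDisjoint (↑(Finset.Icc 1 m))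
      fun j => (Prod.snd ⁻¹' Metric.closedBall (c j) r : Set ((Fin n → ℝ) × Rd d)) := by
    intro i _ j _ hij
    refine Disjoint.preimage _ (Metric.closedBall_disjoint_closedBall ?_)
    have h1 : (1 : ℝ) ≤ |(i : ℝ) - j| := by
      have : (1 : ℤ) ≤ |(i : ℤ) - j| := Int.one_le_abs (by omega)
      exact_mod_cast this
    rw [dist_eq_norm, ← sub_smul, norm_smul, he, mul_one, ← mul_sub, Real.norm_eq_abs, abs_mul,
      abs_of_pos (by positivity : 0 < 3 * r)]
    nlinarith
  have hsum := Finset.sum_le_sum hstep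
  rw [Finset.sum_add_distrib, Finset.sum_const, Finset.sum_const, Nat.card_Icc,
    Nat.add_sub_cancel, nsmul_eq_mul, nsmul_eq_mul] at hsum
  refine hsum.trans ?_
  gcongr
  rw [← lintegral_biUnion_finset hdisj
    fun j _ => measurable_snd Metric.isClosed_closedBall.measurableSet]
  exact (setLIntegral_le_lintegral _ _).trans (lintegral_nnnorm_le_Bnorm hs.le ς)

lemma setLIntegral_closedBall_pow_le {n d : ℕ} (hd : 1 ≤ d) {s : ℝ} (hs : 0 < s) (hs1 : s ≤ 1)
    {ς : (Fin n → ℝ) × Rd d → ℂ} (hς : AEStronglyMeasurable ς volume) (k : ℕ) :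
    ∫⁻ p in Prod.snd ⁻¹' Metric.closedBall 0 ((4 : ℝ)⁻¹ ^ k), (‖ς p‖₊ : ℝ≥0∞) ≤
      ENNReal.ofReal (4 * ((2 : ℝ) ^ (-s)) ^ k) * Bnorm n d s ς := by
  have hhalf : (2 : ℝ)⁻¹ ≤ 2 ^ (-s) := by
    rw [← Real.rpow_neg_one]
    exact Real.rpow_le_rpow_of_exponent_le (by norm_num) (by linarith)
  rcases lt_or_ge k 2 with hk | hk
  · refine (setLIntegral_le_lintegral _ _).trans ((lintegral_nnnorm_le_Bnorm hs.le ς).trans ?_)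
    refine le_mul_of_one_le_left zero_le ?_
    rw [ENNReal.one_le_ofReal]
    interval_cases k
    · norm_num
    · linarith
  have hpow : (3 : ℝ) * 4⁻¹ ^ k * ((2 ^ k : ℕ) : ℝ) = 3 * 2⁻¹ ^ k := by
    push_cast
    rw [mul_assoc, ← mul_pow]
    norm_num
  have hsmall : (2 : ℝ)⁻¹ ^ k ≤ 2⁻¹ ^ 2 := pow_le_pow_of_le_one (by norm_num) (by norm_num) hk
  have hmain := nsmul_setLIntegral_closedBall_le hd hs hς (r := (4 : ℝ)⁻¹ ^ k) (by positivity)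
    (2 ^ k) (by rw [hpow]; norm_num at hsmall ⊢; linarith)
  rw [hpow] at hmain
  have hm0 : ((2 ^ k : ℕ) : ℝ≥0∞) ≠ 0 := by simp
  have hmt : ((2 ^ k : ℕ) : ℝ≥0∞) ≠ ⊤ := ENNReal.natCast_ne_top _
  refine (ENNReal.mul_le_mul_iff_right hm0 hmt).mp (hmain.trans ?_)
  have hreal : 1 + (2 : ℝ) ^ k * (3 * 2⁻¹ ^ k) ^ s ≤ 2 ^ k * (4 * (2 ^ (-s)) ^ k) := by
    have h3 : (3 : ℝ) ^ s ≤ 3 := by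
      simpa using Real.rpow_le_rpow_of_exponent_le (x := 3) (by norm_num) hs1
    have h2 : ((2 : ℝ)⁻¹ ^ k) ^ s = (2 ^ (-s)) ^ k := by
      rw [← Real.rpow_natCast, ← Real.rpow_natCast, Real.rpow_neg (by norm_num),
        ← Real.inv_rpow (by norm_num), ← Real.rpow_mul (by norm_num),
        ← Real.rpow_mul (by norm_num), mul_comm]
    have h1 : 1 ≤ (2 : ℝ) ^ k * (2 ^ (-s)) ^ k := by
      rw [← mul_pow]
      exact one_le_pow₀ (by linarith)
    rw [Real.mul_rpow (by norm_num) (by positivity), h2]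
    have := mul_le_mul_of_nonneg_right h3 (zero_le_one.trans h1)
    linarith
  have hcast : ((2 ^ k : ℕ) : ℝ≥0∞) = ENNReal.ofReal (2 ^ k) := by
    rw [← ENNReal.ofReal_natCast]; push_cast; rfl
  rw [hcast, ← mul_assoc, ← mul_assoc, ← ENNReal.ofReal_mul (by positivity),
    ← ENNReal.ofReal_mul (by positivity)]
  nth_rewrite 1 [← one_mul (Bnorm n d s ς)]
  rw [← add_mul, ← ENNReal.ofReal_one, ← ENNReal.ofReal_add zero_le_one (by positivity)]
  gcongr

lemma exists_rpow_neg_le_pow {s : ℝ} (hs : 0 < s) {x : ℝ} (hx : 0 < x) (hx1 : x ≤ 1) :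
    ∃ k : ℕ, x ≤ (4 : ℝ)⁻¹ ^ k ∧ x ^ (-(s / 4)) ≤ ((2 : ℝ) ^ (s / 2)) ^ (k + 1) := by
  obtain ⟨k, hk, hk'⟩ := exists_nat_pow_near ((one_le_inv₀ hx).mpr hx1) (by norm_num : (1 : ℝ) < 4)
  refine ⟨k, ?_, ?_⟩
  · rw [inv_pow]
    exact (le_inv_comm₀ (by positivity) hx).mp hk
  · have h4 : ((2 : ℝ) ^ (s / 2)) ^ (k + 1) = (4 ^ (k + 1)) ^ (s / 4) := by
      rw [← Real.rpow_natCast, ← Real.rpow_natCast, show (4 : ℝ) = 2 ^ (2 : ℝ) by norm_num,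
        ← Real.rpow_mul (by norm_num), ← Real.rpow_mul (by norm_num),
        ← Real.rpow_mul (by norm_num)]
      ring_nf
    rw [h4, Real.rpow_neg hx.le, ← Real.inv_rpow hx.le]
    exact Real.rpow_le_rpow (by positivity) hk'.le (by positivity)

lemma ofReal_norm_rpow_neg_le_tsum {E : Type*} [SeminormedAddCommGroup E] {s : ℝ} (hs : 0 < s)
    (v : E) :
    ENNReal.ofReal (‖v‖ ^ (-(s / 4))) ≤
      1 + ∑' k : ℕ, (Metric.closedBall (0 : E) ((4 : ℝ)⁻¹ ^ k)).indicator
        (fun _ => ENNReal.ofReal (((2 : ℝ) ^ (s / 2)) ^ (k + 1))) v := by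
  rcases (norm_nonneg v).eq_or_lt with h0 | h0
  · rw [← h0, Real.zero_rpow (by linarith)]
    simp
  rcases le_or_gt ‖v‖ 1 with h1 | h1
  · obtain ⟨k, hk, hk'⟩ := exists_rpow_neg_le_pow hs h0 h1
    refine le_trans ?_ (le_trans (ENNReal.le_tsum k) le_add_self)
    rw [Set.indicator_of_mem (by simpa using hk)]
    exact ENNReal.ofReal_le_ofReal hk'
  · refine le_trans ?_ le_self_add
    rw [ENNReal.ofReal_le_one]
    exact Real.rpow_le_one_of_one_le_of_nonpos h1.le (by linarith)

/-- Lemma 3.4: there are `δ = δ(ε,d) > 0` and `C = C(ε,d)`, independent of `n`,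
with `∬ |v|^{−δ} |ς(α,v)| dα dv ≤ C ‖ς‖_{ℬ_{ε∧1}}`. -/
theorem statement10 (d : ℕ) (hd : 1 ≤ d) (ε : ℝ) (hε : 0 < ε) :
    ∃ δ C : ℝ, 0 < δ ∧ 0 < C ∧ ∀ n : ℕ, 1 ≤ n →
      ∀ ς : (Fin n → ℝ) × Rd d → ℂ, Integrable ς volume →
        Bnorm n d (min ε 1) ς ≠ ⊤ →
        (∫⁻ p : (Fin n → ℝ) × Rd d,
            ENNReal.ofReal (‖p.2‖ ^ (-δ)) * (‖ς p‖₊ : ℝ≥0∞)) ≤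
          ENNReal.ofReal C * Bnorm n d (min ε 1) ς := by
  set s : ℝ := min ε 1
  have hs : 0 < s := lt_min hε one_pos
  have hs1 : s ≤ 1 := min_le_right _ _
  set b : ℝ := 2 ^ (s / 2)
  have hb : 1 < b := Real.one_lt_rpow (by norm_num) (by linarith)
  have hb0 : 0 < b := zero_lt_one.trans hb
  have hbinv : b⁻¹ < 1 := inv_lt_one_of_one_lt₀ hb
  have hbs : (2 : ℝ) ^ (-s) = b⁻¹ * b⁻¹ := by
    rw [← mul_inv, ← Real.rpow_add (by norm_num), add_halves, Real.rpow_neg (by norm_num)]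
  have hgeom : HasSum (fun k : ℕ => 4 * b * b⁻¹ ^ k) (4 * b * (1 - b⁻¹)⁻¹) :=
    (hasSum_geometric_of_lt_one (by positivity) hbinv).mul_left _
  have hC : 0 < 4 * b * (1 - b⁻¹)⁻¹ := by
    have : 0 < 1 - b⁻¹ := by linarith
    positivity
  refine ⟨s / 4, 1 + 4 * b * (1 - b⁻¹)⁻¹, by linarith, by linarith, ?_⟩
  intro n _ ς hς _
  have hm : AEMeasurable (fun p => (‖ς p‖₊ : ℝ≥0∞)) volume := hς.aestronglyMeasurable.enorm
  have hS : ∀ k : ℕ, MeasurableSet (Prod.snd ⁻¹' Metric.closedBall 0 ((4 : ℝ)⁻¹ ^ k) :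
      Set ((Fin n → ℝ) × Rd d)) :=
    fun k => measurable_snd Metric.isClosed_closedBall.measurableSet
  have hterm : ∀ k : ℕ, ENNReal.ofReal (b ^ (k + 1)) *
      ∫⁻ p in Prod.snd ⁻¹' Metric.closedBall 0 ((4 : ℝ)⁻¹ ^ k), (‖ς p‖₊ : ℝ≥0∞) ≤
        ENNReal.ofReal (4 * b * b⁻¹ ^ k) * Bnorm n d s ς := fun k => by
    refine (mul_le_mul_right
      (setLIntegral_closedBall_pow_le hd hs hs1 hς.aestronglyMeasurable k) _).trans_eq ?_
    rw [← mul_assoc, ← ENNReal.ofReal_mul (by positivity), hbs]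
    congr 2
    rw [mul_pow, inv_pow]
    field_simp
    ring
  calc _ ≤ ∫⁻ p : (Fin n → ℝ) × Rd d, ((‖ς p‖₊ : ℝ≥0∞) +
        ∑' k : ℕ, (Prod.snd ⁻¹' Metric.closedBall 0 ((4 : ℝ)⁻¹ ^ k)).indicator
          (fun p => ENNReal.ofReal (b ^ (k + 1)) * (‖ς p‖₊ : ℝ≥0∞)) p) := by
        refine lintegral_mono fun p => ?_
        refine (mul_le_mul_left (ofReal_norm_rpow_neg_le_tsum hs p.2) _).trans_eq ?_
        rw [add_mul, one_mul, ← ENNReal.tsum_mul_right]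
        congr 2
        ext k
        by_cases hp : p.2 ∈ Metric.closedBall 0 ((4 : ℝ)⁻¹ ^ k)
        · rw [Set.indicator_of_mem hp, Set.indicator_of_mem (Set.mem_preimage.mpr hp)]
        · rw [Set.indicator_of_notMem hp, zero_mul,
            Set.indicator_of_notMem (by rwa [Set.mem_preimage])]
    _ = (∫⁻ p, (‖ς p‖₊ : ℝ≥0∞)) + ∑' k : ℕ, ENNReal.ofReal (b ^ (k + 1)) *
        ∫⁻ p in Prod.snd ⁻¹' Metric.closedBall 0 ((4 : ℝ)⁻¹ ^ k), (‖ς p‖₊ : ℝ≥0∞) := by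
        rw [lintegral_add_left' hm,
          lintegral_tsum fun k => (hm.const_mul _).indicator (hS k)]
        congr 2
        ext k
        rw [lintegral_indicator (hS k), lintegral_const_mul' _ _ ENNReal.ofReal_ne_top]
    _ ≤ Bnorm n d s ς + ∑' k : ℕ, ENNReal.ofReal (4 * b * b⁻¹ ^ k) * Bnorm n d s ς :=
        add_le_add (lintegral_nnnorm_le_Bnorm hs.le ς) (ENNReal.tsum_le_tsum hterm)
    _ = _ := by
        rw [ENNReal.tsum_mul_right, ← ENNReal.ofReal_tsum_of_nonneg (fun k => by positivity)
          hgeom.summable, hgeom.tsum_eq, ENNReal.ofReal_add zero_le_one hC.le, add_mul,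
          ENNReal.ofReal_one, one_mul]


end
end
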